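/- Let (μ_i, ν_i)_{i∈{1,…,d}} be irreducible pairs of probability measures on ℝ (with finite first moments, in convex order μ_i ⪯_c ν_i) with domains (I_i, J_i). Set I = I_1 × … × I_d, J = J_1 × … × J_d, μ^⊗ = μ_1 ⊗ … ⊗ μ_d, ν^⊗ = ν_1 ⊗ … ⊗ ν_d. Fix a ∈ I and C ∈ ℝ, and let Λ be the set of all functions χ : J → ℝ such that (1) χ is a real-valued convex function on J, (2) χ ≥ 0 and χ(a) = 0, and (3) ∫ χ d(ν^⊗ − μ^⊗) ≤ C. Then: (a) Λ is locally bounded, i.e., for every compact subset K of J there exists M = M(K) such that χ ≤ M on K for every χ ∈ Λ; and (b) every sequence (χ_n)_n in Λ admits a subsequence (χ_{n_j})_j and a real-valued convex function χ on J such that χ_{n_j}(x) → χ(x) as j → ∞ for every x ∈ J. -/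

import Mathlib

open MeasureTheory Filter

noncomputable section

/-- Convex order for probability measures on ℝ. -/
def ConvexOrder1 (μ ν : Measure ℝ) : Prop :=
  ∀ f : ℝ → ℝ, ConvexOn ℝ Set.univ f → Integrable f μ → Integrable f ν →
    ∫ x, f x ∂μ ≤ ∫ x, f x ∂ν

/-- Potential function u_μ(x) = ∫ |x - y| dμ(y). -/
def potentialFn (μ : Measure ℝ) (x : ℝ) : ℝ := ∫ y, |x - y| ∂μ

/-- Irreducibility of a pair μ ⪯_c ν. -/
def IrreduciblePair (μ ν : Measure ℝ) : Prop :=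
  IsPreconnected {x | potentialFn μ x < potentialFn ν x} ∧
  μ {x | potentialFn μ x < potentialFn ν x} = 1

/-- Membership in the class Λ = Λ(a, C, μ, ν): χ is convex, nonnegative and vanishing at a
on the rectangle Jset, and satisfies ∫ χ d(ν^⊗ − μ^⊗) ≤ C (the integrals over Jset being
well-defined, with the μ^⊗-integral finite). -/
def memLambda (d : ℕ) (Jset : Set (Fin d → ℝ)) (a : Fin d → ℝ) (C : ℝ)
    (μ ν : Fin d → Measure ℝ) (χ : (Fin d → ℝ) → ℝ) : Prop :=
  ConvexOn ℝ Jset χ ∧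
  (∀ x ∈ Jset, 0 ≤ χ x) ∧ χ a = 0 ∧
  (∫⁻ x in Jset, ENNReal.ofReal (χ x) ∂(Measure.pi μ)) ≠ ⊤ ∧
  (∫⁻ x in Jset, ENNReal.ofReal (χ x) ∂(Measure.pi ν)) ≤
    ENNReal.ofReal C + ∫⁻ x in Jset, ENNReal.ofReal (χ x) ∂(Measure.pi μ)

section

lemma exists_subgradient {E : Type*} [NormedAddCommGroup E] [NormedSpace ℝ E]
    [FiniteDimensional ℝ E] {s : Set E} {f : E → ℝ} (hf : ConvexOn ℝ s f) {c : E}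
    (hc : c ∈ interior s) : ∃ l : E →L[ℝ] ℝ, ∀ x ∈ s, f c + l (x - c) ≤ f x := by
  have hfi : ConvexOn ℝ (interior s) f := hf.subset interior_subset hf.1.interior
  have hcont : ContinuousOn f (interior s) := hf.continuousOn_interior
  set T : Set (E × ℝ) := {p | p.1 ∈ interior s ∧ f p.1 < p.2} with hT
  have hTc : Convex ℝ T := hfi.convex_strict_epigraph
  have hTo : IsOpen T := by
    have h1 : IsOpen {p : E × ℝ | p.1 ∈ interior s} := isOpen_interior.preimage continuous_fst
    have h2 : ContinuousOn (fun p : E × ℝ => p.2 - f p.1) {p : E × ℝ | p.1 ∈ interior s} :=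
      continuous_snd.continuousOn.sub (hcont.comp continuous_fst.continuousOn (fun p hp => hp))
    have h3 := h2.isOpen_inter_preimage h1 (isOpen_Ioi (a := (0 : ℝ)))
    convert h3 using 1
    ext p
    simp [hT]
  have hcT : (c, f c) ∉ T := by simp [hT]
  obtain ⟨L, hL⟩ := geometric_hahn_banach_point_open hTc hTo hcT
  have hdec : ∀ (x : E) (r : ℝ), L (x, r) = L (x, 0) + r * L (0, 1) := by
    intro x r
    have : (x, r) = (x, (0 : ℝ)) + r • ((0 : E), (1 : ℝ)) := by ext <;> simp
    rw [this, map_add, map_smul, smul_eq_mul]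
  have hβ : 0 < L (0, 1) := by
    have := hL (c, f c + 1) ⟨hc, by simp⟩
    rw [hdec c (f c), hdec c (f c + 1)] at this
    linarith
  set β := L (0, 1)
  let l : E →L[ℝ] ℝ := (-(1 / β)) • (L.comp (ContinuousLinearMap.inl ℝ E ℝ))
  have hl : ∀ x, l x = -(1 / β) * L (x, 0) := fun x => by simp [l]
  have hint : ∀ x ∈ interior s, f c + l (x - c) ≤ f x := by
    intro x hx
    refine le_of_forall_pos_lt_add fun ε hε => ?_
    have := hL (x, f x + ε) ⟨hx, by simpa using hε⟩
    rw [hdec c (f c), hdec x (f x + ε)] at this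
    rw [map_sub, hl, hl]
    have h4 : β * (f c + (-(1 / β) * L (x, 0) - -(1 / β) * L (c, 0))) < β * (f x + ε) := by
      field_simp
      linarith
    exact lt_of_mul_lt_mul_left h4 hβ.le
  refine ⟨l, fun x hx => ?_⟩
  have htend : Tendsto (fun t : ℝ => c + t • (x - c)) (nhdsWithin 0 (Set.Ioi 0)) (nhds c) := by
    have : Continuous (fun t : ℝ => c + t • (x - c)) := by fun_prop
    have h5 := this.tendsto 0
    simp only [zero_smul, add_zero] at h5
    exact h5.mono_left nhdsWithin_le_nhds
  have hev := htend.eventually (isOpen_interior.mem_nhds hc)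
  have hev2 : ∀ᶠ t : ℝ in nhdsWithin 0 (Set.Ioi 0), t ∈ Set.Ioo (0 : ℝ) 1 :=
    Ioo_mem_nhdsGT one_pos
  obtain ⟨t, ht1, ht0, ht1'⟩ := (hev.and hev2).exists
  have h6 := hint _ ht1
  have h7 := hf.2 (interior_subset hc) hx (by linarith : 0 ≤ 1 - t) ht0.le (by ring)
  have h8 : (1 - t) • c + t • x = c + t • (x - c) := by
    rw [sub_smul, smul_sub, one_smul]; abel
  rw [h8] at h7
  simp only [add_sub_cancel_left, map_smul, smul_eq_mul] at h6 h7
  have : t * (f c + l (x - c)) ≤ t * f x := by nlinarith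
  exact le_of_mul_le_mul_left this ht0

lemma exists_subgradient_real {s : Set ℝ} {f : ℝ → ℝ} (hf : ConvexOn ℝ s f) {c : ℝ}
    (hc : c ∈ interior s) : ∃ l : ℝ, ∀ x ∈ s, f c + l * (x - c) ≤ f x := by
  obtain ⟨l, hl⟩ := exists_subgradient hf hc
  refine ⟨l 1, fun x hx => ?_⟩
  have : l (x - c) = l 1 * (x - c) := by
    rw [mul_comm, ← smul_eq_mul, ← map_smul, smul_eq_mul, mul_one]
  rw [← this]
  exact hl x hx

/-- nonnegative measurable functions, convex on `J`. -/
structure Cls {E : Type*} [AddCommGroup E] [Module ℝ E] [MeasurableSpace E] (J : Set E)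
    (f : E → ℝ) : Prop where
  cvx : ConvexOn ℝ J f
  nonneg : ∀ x, 0 ≤ f x
  meas : Measurable f

/-! one-dimensional facts -/

structure Pair (μ ν : Measure ℝ) (I J : Set ℝ) : Prop where
  pμ : IsProbabilityMeasure μ
  pν : IsProbabilityMeasure ν
  iμ : Integrable id μ
  iν : Integrable id ν
  ord : ConvexOrder1 μ ν
  irr : IrreduciblePair μ ν
  hI : I = {x | potentialFn μ x < potentialFn ν x}
  hJ : Set.OrdConnected J
  hJfull : ν J = 1
  hJmin : ∀ J' : Set ℝ, Set.OrdConnected J' → ν J' = 1 → J ⊆ J'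

variable {μ ν : Measure ℝ} {I J : Set ℝ}

lemma integrable_abs_sub [IsProbabilityMeasure μ] (h : Integrable id μ) (x : ℝ) :
    Integrable (fun y => |x - y|) μ := by
  exact ((integrable_const x).sub h).abs

lemma integrable_affine [IsProbabilityMeasure μ] (h : Integrable id μ) (α β : ℝ) :
    Integrable (fun y => α * y + β) μ :=
  (h.const_mul α).add (integrable_const β)

lemma integral_affine [IsProbabilityMeasure μ] (h : Integrable id μ) (α β : ℝ) :
    ∫ y, (α * y + β) ∂μ = α * (∫ y, y ∂μ) + β := by
  have h1 : Integrable (fun y : ℝ => α * y) μ := h.const_mul α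
  rw [integral_add h1 (integrable_const β), integral_const_mul]
  simp

lemma Pair.mean_eq (P : Pair μ ν I J) : ∫ x, x ∂μ = ∫ x, x ∂ν := by
  have := P.pμ
  have := P.pν
  apply le_antisymm
  · exact P.ord id (convexOn_id convex_univ) P.iμ P.iν
  · have := P.ord (fun x => -x) ((concaveOn_id convex_univ).neg) P.iμ.neg P.iν.neg
    rw [integral_neg, integral_neg] at this
    linarith

lemma Pair.integral_affine_eq (P : Pair μ ν I J) (α β : ℝ) :
    ∫ y, (α * y + β) ∂μ = ∫ y, (α * y + β) ∂ν := by
  have := P.pμ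
  have := P.pν
  rw [integral_affine P.iμ, integral_affine P.iν, P.mean_eq]

lemma continuous_potentialFn [IsProbabilityMeasure μ] (h : Integrable id μ) :
    Continuous (potentialFn μ) := by
  have : LipschitzWith 1 (potentialFn μ) := by
    refine LipschitzWith.of_dist_le_mul fun x y => ?_
    simp only [potentialFn, NNReal.coe_one, one_mul, Real.dist_eq]
    rw [← integral_sub (integrable_abs_sub h x) (integrable_abs_sub h y)]
    have := norm_integral_le_of_norm_le_const (μ := μ) (f := fun t => |x - t| - |y - t|)
      (C := |x - y|) (Eventually.of_forall fun t => by
        rw [Real.norm_eq_abs]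
        have := abs_abs_sub_abs_le_abs_sub (x - t) (y - t)
        simpa using this)
    simpa using this
  exact this.continuous

lemma Pair.isOpen (P : Pair μ ν I J) : IsOpen I := by
  have := P.pμ
  have := P.pν
  rw [P.hI]
  exact isOpen_lt (continuous_potentialFn P.iμ) (continuous_potentialFn P.iν)

lemma Pair.preconn (P : Pair μ ν I J) : IsPreconnected I := by
  rw [P.hI]; exact P.irr.1

lemma Pair.full (P : Pair μ ν I J) : μ I = 1 := by
  rw [P.hI]; exact P.irr.2

lemma Pair.aeI (P : Pair μ ν I J) : ∀ᵐ x ∂μ, x ∈ I := by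
  have := P.pμ
  exact (prob_compl_eq_zero_iff P.isOpen.measurableSet).2 P.full

lemma Pair.aeJ (P : Pair μ ν I J) : ∀ᵐ x ∂ν, x ∈ J := by
  have := P.pν
  exact (prob_compl_eq_zero_iff P.hJ.measurableSet).2 P.hJfull

lemma Pair.lt (P : Pair μ ν I J) {x : ℝ} (hx : x ∈ I) : potentialFn μ x < potentialFn ν x := by
  rw [P.hI] at hx; exact hx

lemma Pair.ge (P : Pair μ ν I J) {x : ℝ} (hx : x ∉ I) : potentialFn ν x ≤ potentialFn μ x := by
  rw [P.hI] at hx; exact not_lt.1 hx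

lemma Pair.left_mass (P : Pair μ ν I J) {y : ℝ} (hy : y ∈ J) : ν (Set.Iic y) ≠ 0 := by
  intro h
  have := P.pν
  have h1 : ν (Set.Ioi y) = 1 := by
    rw [← Set.compl_Iic, prob_compl_eq_one_iff measurableSet_Iic]; exact h
  exact lt_irrefl y (P.hJmin _ Set.ordConnected_Ioi h1 hy)

lemma Pair.right_mass (P : Pair μ ν I J) {y : ℝ} (hy : y ∈ J) : ν (Set.Ici y) ≠ 0 := by
  intro h
  have := P.pν
  have h1 : ν (Set.Iio y) = 1 := by
    rw [← Set.compl_Ici, prob_compl_eq_one_iff measurableSet_Ici]; exact h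
  exact lt_irrefl y (P.hJmin _ Set.ordConnected_Iio h1 hy)

lemma mean_le_pot_left [IsProbabilityMeasure μ] (h : Integrable id μ) (x : ℝ) :
    (∫ y, y ∂μ) - x ≤ potentialFn μ x := by
  have h1 := integral_affine h 1 (-x)
  have h2 : ∫ y, (1 * y + -x) ∂μ ≤ potentialFn μ x :=
    integral_mono (integrable_affine h 1 (-x)) (integrable_abs_sub h x)
      (fun y => by have := neg_abs_le (x - y); simp only; linarith)
  linarith

lemma mean_le_pot_right [IsProbabilityMeasure μ] (h : Integrable id μ) (x : ℝ) :
    x - (∫ y, y ∂μ) ≤ potentialFn μ x := by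
  have h1 := integral_affine h (-1) x
  have h2 : ∫ y, (-1 * y + x) ∂μ ≤ potentialFn μ x :=
    integral_mono (integrable_affine h (-1) x) (integrable_abs_sub h x)
      (fun y => by have := le_abs_self (x - y); simp only; linarith)
  linarith

lemma pot_eq_left [IsProbabilityMeasure μ] (h : Integrable id μ) (x : ℝ)
    (hx : ∀ᵐ y ∂μ, x ≤ y) : potentialFn μ x = (∫ y, y ∂μ) - x := by
  have h1 := integral_affine h 1 (-x)
  have h2 : potentialFn μ x = ∫ y, (1 * y + -x) ∂μ :=
    integral_congr_ae (hx.mono fun y hy => by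
      simp only; rw [abs_of_nonpos (by linarith)]; ring)
  linarith

lemma pot_eq_right [IsProbabilityMeasure μ] (h : Integrable id μ) (x : ℝ)
    (hx : ∀ᵐ y ∂μ, y ≤ x) : potentialFn μ x = x - (∫ y, y ∂μ) := by
  have h1 := integral_affine h (-1) x
  have h2 : potentialFn μ x = ∫ y, (-1 * y + x) ∂μ :=
    integral_congr_ae (hx.mono fun y hy => by
      simp only; rw [abs_of_nonneg (by linarith)]; ring)
  linarith

lemma Pair.I_sub_J (P : Pair μ ν I J) : I ⊆ J := by
  have := P.pμ
  have := P.pν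
  intro x hx
  by_contra hxJ
  have hlt := P.lt hx
  by_cases hc : ∃ y ∈ J, y < x
  · obtain ⟨y, hy, hyx⟩ := hc
    have : ∀ z ∈ J, z ≤ x := by
      intro z hz
      by_contra hzx
      exact hxJ (P.hJ.out hy hz ⟨hyx.le, (not_le.1 hzx).le⟩)
    have h1 := pot_eq_right P.iν x (P.aeJ.mono this)
    have h2 := mean_le_pot_right P.iμ x
    rw [P.mean_eq] at h2
    linarith
  · push Not at hc
    have h1 := pot_eq_left P.iν x (P.aeJ.mono hc)
    have h2 := mean_le_pot_left P.iμ x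
    rw [P.mean_eq] at h2
    linarith

lemma Pair.I_sub_int (P : Pair μ ν I J) : I ⊆ interior J :=
  interior_maximal P.I_sub_J P.isOpen

/-- a point of `J`, not in `I`, left of `I` -/
lemma Pair.left_end (P : Pair μ ν I J) {y b : ℝ} (hb : b ∈ I) (hy : y ∉ I)
    (hyb : y < b) : (∀ᵐ x ∂μ, y < x) ∧ (∀ᵐ x ∂ν, y ≤ x) ∧ J ⊆ Set.Ici y := by
  have := P.pμ
  have := P.pν
  have h0 : ∀ x ∈ I, y < x := by
    intro x hx
    by_contra hxy
    exact hy (P.preconn.ordConnected.out hx hb ⟨not_lt.1 hxy, hyb.le⟩)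
  have h1 : ∀ᵐ x ∂μ, y < x := P.aeI.mono h0
  have h2 := pot_eq_left P.iμ y (h1.mono fun x hx => hx.le)
  have h3 := P.ge hy
  have h4 : ∀ᵐ x ∂ν, y ≤ x := by
    have h5 : Integrable (fun x => |y - x| - (1 * x + -y)) ν :=
      (integrable_abs_sub P.iν y).sub (integrable_affine P.iν 1 (-y))
    have h6 : ∫ x, (|y - x| - (1 * x + -y)) ∂ν ≤ 0 := by
      rw [integral_sub (integrable_abs_sub P.iν y) (integrable_affine P.iν 1 (-y)),
        integral_affine P.iν, ← P.mean_eq]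
      change potentialFn ν y - _ ≤ 0
      linarith
    have h7 : 0 ≤ fun x => |y - x| - (1 * x + -y) := fun x => by
      have := neg_abs_le (y - x); simp only [Pi.zero_apply]; linarith
    have h8 : ∫ x, (|y - x| - (1 * x + -y)) ∂ν = 0 := le_antisymm h6 (integral_nonneg h7)
    rw [integral_eq_zero_iff_of_nonneg h7 h5] at h8
    filter_upwards [h8] with x hx
    simp only [Pi.zero_apply] at hx
    by_contra hlt
    rw [abs_of_nonneg (by linarith)] at hx
    linarith
  refine ⟨h1, h4, P.hJmin _ Set.ordConnected_Ici ?_⟩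
  exact (prob_compl_eq_zero_iff measurableSet_Ici).1 h4

lemma Pair.right_end (P : Pair μ ν I J) {y b : ℝ} (hb : b ∈ I) (hy : y ∉ I)
    (hyb : b < y) : (∀ᵐ x ∂μ, x < y) ∧ (∀ᵐ x ∂ν, x ≤ y) ∧ J ⊆ Set.Iic y := by
  have := P.pμ
  have := P.pν
  have h0 : ∀ x ∈ I, x < y := by
    intro x hx
    by_contra hxy
    exact hy (P.preconn.ordConnected.out hb hx ⟨hyb.le, not_lt.1 hxy⟩)
  have h1 : ∀ᵐ x ∂μ, x < y := P.aeI.mono h0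
  have h2 := pot_eq_right P.iμ y (h1.mono fun x hx => hx.le)
  have h3 := P.ge hy
  have h4 : ∀ᵐ x ∂ν, x ≤ y := by
    have h5 : Integrable (fun x => |y - x| - (-1 * x + y)) ν :=
      (integrable_abs_sub P.iν y).sub (integrable_affine P.iν (-1) y)
    have h6 : ∫ x, (|y - x| - (-1 * x + y)) ∂ν ≤ 0 := by
      rw [integral_sub (integrable_abs_sub P.iν y) (integrable_affine P.iν (-1) y),
        integral_affine P.iν, ← P.mean_eq]
      change potentialFn ν y - _ ≤ 0
      linarith
    have h7 : 0 ≤ fun x => |y - x| - (-1 * x + y) := fun x => by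
      have := le_abs_self (y - x); simp only [Pi.zero_apply]; linarith
    have h8 : ∫ x, (|y - x| - (-1 * x + y)) ∂ν = 0 := le_antisymm h6 (integral_nonneg h7)
    rw [integral_eq_zero_iff_of_nonneg h7 h5] at h8
    filter_upwards [h8] with x hx
    simp only [Pi.zero_apply] at hx
    by_contra hlt
    rw [abs_of_nonpos (by linarith)] at hx
    linarith
  refine ⟨h1, h4, P.hJmin _ Set.ordConnected_Iic ?_⟩
  exact (prob_compl_eq_zero_iff measurableSet_Iic).1 h4

lemma Pair.mem_left (P : Pair μ ν I J) {y p b : ℝ} (hb : b ∈ I) (hy : y ∈ J) (h1 : y < p)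
    (h2 : p ≤ b) : p ∈ I := by
  by_contra hp
  have hpb : p < b := lt_of_le_of_ne h2 (fun h => hp (h ▸ hb))
  have := (P.left_end hb hp hpb).2.2 hy
  exact absurd h1 (not_lt.2 this)

lemma Pair.mem_right (P : Pair μ ν I J) {y p b : ℝ} (hb : b ∈ I) (hy : y ∈ J) (h1 : p < y)
    (h2 : b ≤ p) : p ∈ I := by
  by_contra hp
  have hpb : b < p := lt_of_le_of_ne h2 (fun h => hp (h ▸ hb))
  have := (P.right_end hb hp hpb).2.2 hy
  exact absurd h1 (not_lt.2 this)

end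

section

variable {μ ν : Measure ℝ} {I J : Set ℝ}

lemma Pair.nonempty (P : Pair μ ν I J) : I.Nonempty := by
  by_contra h
  rw [Set.not_nonempty_iff_eq_empty] at h
  have := P.full
  rw [h] at this
  simp at this

lemma Pair.aeJμ (P : Pair μ ν I J) : ∀ᵐ x ∂μ, x ∈ J := P.aeI.mono fun _ h => P.I_sub_J h

lemma Pair.cvxJ (P : Pair μ ν I J) : Convex ℝ J := P.hJ.convex

lemma Pair.order_lintegral (P : Pair μ ν I J) {f : ℝ → ℝ} (hf : ConvexOn ℝ J f)
    (h0 : ∀ x ∈ J, 0 ≤ f x) :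
    ∫⁻ x, ENNReal.ofReal (f x) ∂μ ≤ ∫⁻ x, ENNReal.ofReal (f x) ∂ν := by
  have := P.pμ
  have := P.pν
  obtain ⟨t0, ht0⟩ := P.nonempty
  have ht0J := P.I_sub_J ht0
  let S : ℕ → Set (ℝ × ℝ) := fun n => {p | |p.1| ≤ n ∧ ∀ t ∈ J, p.1 * t + p.2 ≤ f t}
  let g : ℕ → ℝ → ℝ := fun n x => ⨆ p : S n, (p.1.1 * x + p.1.2)
  have hne : ∀ n, Nonempty (S n) := fun n => ⟨⟨(0, 0), by simp [S]; exact h0⟩⟩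
  have hub : ∀ n x (p : S n), p.1.1 * x + p.1.2 ≤ f t0 + n * |x - t0| := by
    intro n x p
    have h1 := p.2.2 t0 ht0J
    have h2 : p.1.1 * (x - t0) ≤ n * |x - t0| := by
      calc p.1.1 * (x - t0) ≤ |p.1.1 * (x - t0)| := le_abs_self _
        _ = |p.1.1| * |x - t0| := abs_mul _ _
        _ ≤ n * |x - t0| := by gcongr; exact p.2.1
    nlinarith
  have hbdd : ∀ n x, BddAbove (Set.range fun p : S n => p.1.1 * x + p.1.2) := by
    intro n x
    exact ⟨f t0 + n * |x - t0|, by rintro _ ⟨p, rfl⟩; exact hub n x p⟩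
  have hg0 : ∀ n x, 0 ≤ g n x := by
    intro n x
    have := le_ciSup (hbdd n x) ⟨(0, 0), by simp [S]; exact h0⟩
    simpa [g] using this
  have hgub : ∀ n x, g n x ≤ f t0 + n * |x - t0| := fun n x => ciSup_le (hub n x)
  have hgf : ∀ n, ∀ x ∈ J, g n x ≤ f x := fun n x hx => ciSup_le fun p => p.2.2 x hx
  have hgc : ∀ n, ConvexOn ℝ Set.univ (g n) := by
    intro n
    refine ⟨convex_univ, fun x _ y _ a b ha hb hab => ciSup_le fun p => ?_⟩
    have h1 := le_ciSup (hbdd n x) p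
    have h2 := le_ciSup (hbdd n y) p
    simp only [smul_eq_mul]
    change _ ≤ a * g n x + b * g n y
    have h3 := mul_le_mul_of_nonneg_left h1 ha
    have h4 := mul_le_mul_of_nonneg_left h2 hb
    have : p.1.2 = a * p.1.2 + b * p.1.2 := by rw [← add_mul, hab, one_mul]
    change a * _ ≤ a * g n x at h3
    change b * _ ≤ b * g n y at h4
    nlinarith
  have hgcont : ∀ n, Continuous (g n) := fun n => by
    rw [← continuousOn_univ]
    exact (hgc n).continuousOn isOpen_univ
  have hint : ∀ n (ρ : Measure ℝ) [IsProbabilityMeasure ρ], Integrable id ρ →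
      Integrable (g n) ρ := by
    intro n ρ _ hρ
    have h1 : Integrable (fun x => f t0 + n * |t0 - x|) ρ :=
      (integrable_const _).add ((integrable_abs_sub hρ t0).const_mul _)
    refine h1.mono' (hgcont n).aestronglyMeasurable (Eventually.of_forall fun x => ?_)
    rw [Real.norm_eq_abs, abs_of_nonneg (hg0 n x), abs_sub_comm]
    exact hgub n x
  have hle : ∀ n, ∫⁻ x, ENNReal.ofReal (g n x) ∂μ ≤ ∫⁻ x, ENNReal.ofReal (f x) ∂ν := by
    intro n
    calc ∫⁻ x, ENNReal.ofReal (g n x) ∂μ ≤ ∫⁻ x, ENNReal.ofReal (g n x) ∂ν := by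
          rw [← ofReal_integral_eq_lintegral_ofReal (hint n μ P.iμ) (Eventually.of_forall (hg0 n)),
            ← ofReal_integral_eq_lintegral_ofReal (hint n ν P.iν) (Eventually.of_forall (hg0 n))]
          exact ENNReal.ofReal_le_ofReal (P.ord _ (hgc n) (hint n μ P.iμ) (hint n ν P.iν))
      _ ≤ _ := lintegral_mono_ae (P.aeJ.mono fun x hx => ENNReal.ofReal_le_ofReal (hgf n x hx))
  calc ∫⁻ x, ENNReal.ofReal (f x) ∂μ
      ≤ ∫⁻ x, liminf (fun n => ENNReal.ofReal (g n x)) atTop ∂μ := by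
        refine lintegral_mono_ae (P.aeI.mono fun x hx => ?_)
        refine le_liminf_of_le (by isBoundedDefault) ?_
        obtain ⟨l, hl⟩ := exists_subgradient_real hf (P.I_sub_int hx)
        obtain ⟨N, hN⟩ := exists_nat_ge |l|
        filter_upwards [eventually_ge_atTop N] with n hn
        apply ENNReal.ofReal_le_ofReal
        have hmem : (l, f x - l * x) ∈ S n := by
          refine ⟨hN.trans (by exact_mod_cast hn), fun t ht => ?_⟩
          have := hl t ht
          simp only; linarith
        have := le_ciSup (hbdd n x) ⟨_, hmem⟩
        simp only at this
        change _ ≤ g n x at this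
        linarith
    _ ≤ liminf (fun n => ∫⁻ x, ENNReal.ofReal (g n x) ∂μ) atTop :=
        lintegral_liminf_le fun n => ((hgcont n).measurable).ennreal_ofReal
    _ ≤ _ := by
        refine (liminf_le_liminf (Eventually.of_forall hle)).trans ?_
        simp

lemma convexOn_sub_affine {f : ℝ → ℝ} (hf : ConvexOn ℝ J f) (α β : ℝ) :
    ConvexOn ℝ J (fun x => f x - (α * x + β)) := by
  refine ⟨hf.1, fun x hx y hy a b ha hb hab => ?_⟩
  have := hf.2 hx hy ha hb hab
  simp only [smul_eq_mul] at *
  have h2 : β = a * β + b * β := by rw [← add_mul, hab, one_mul]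
  nlinarith

lemma Pair.subgr (P : Pair μ ν I J) {f : ℝ → ℝ} (hf : ConvexOn ℝ J f) {b : ℝ} (hb : b ∈ I) :
    ∃ l : ℝ, ∀ x ∈ J, f b + l * (x - b) ≤ f x :=
  exists_subgradient_real hf (P.I_sub_int hb)

lemma Pair.order (P : Pair μ ν I J) {f : ℝ → ℝ} (hf : ConvexOn ℝ J f) (hm : Measurable f)
    (hi : Integrable f ν) : Integrable f μ ∧ ∫ x, f x ∂μ ≤ ∫ x, f x ∂ν := by
  have := P.pμ
  have := P.pν
  obtain ⟨b, hb⟩ := P.nonempty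
  obtain ⟨l, hl⟩ := P.subgr hf hb
  let h : ℝ → ℝ := fun x => f x - (l * x + (f b - l * b))
  have hc : ConvexOn ℝ J h := convexOn_sub_affine hf _ _
  have hn : ∀ x ∈ J, 0 ≤ h x := fun x hx => by have := hl x hx; simp only [h]; linarith
  have hhm : Measurable h := by fun_prop
  have hiν : Integrable h ν := hi.sub (integrable_affine P.iν _ _)
  have h1 := P.order_lintegral hc hn
  have hnν : 0 ≤ᵐ[ν] h := P.aeJ.mono hn
  have hnμ : 0 ≤ᵐ[μ] h := P.aeJμ.mono hn
  have hlt := (hasFiniteIntegral_iff_ofReal hnν).1 hiν.2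
  have hiμ : Integrable h μ :=
    ⟨hhm.aestronglyMeasurable, (hasFiniteIntegral_iff_ofReal hnμ).2 (h1.trans_lt hlt)⟩
  have haμ := integrable_affine P.iμ l (f b - l * b)
  have haν := integrable_affine P.iν l (f b - l * b)
  have hfe : f = fun x => h x + (l * x + (f b - l * b)) := by ext x; simp [h]
  refine ⟨by rw [hfe]; exact hiμ.add haμ, ?_⟩
  rw [hfe, integral_add hiμ haμ, integral_add hiν haν, P.integral_affine_eq]
  rw [integral_eq_lintegral_of_nonneg_ae hnμ hhm.aestronglyMeasurable,
    integral_eq_lintegral_of_nonneg_ae hnν hhm.aestronglyMeasurable]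
  gcongr
  exact hlt.ne

end

section

variable {μ ν : Measure ℝ} {I J : Set ℝ}

structure Gd (ν : Measure ℝ) (J : Set ℝ) (f : ℝ → ℝ) : Prop where
  cvx : ConvexOn ℝ J f
  meas : Measurable f
  int : Integrable f ν

def DD (μ ν : Measure ℝ) (f : ℝ → ℝ) : ℝ := ∫ x, f x ∂ν - ∫ x, f x ∂μ

lemma Gd.nonneg (P : Pair μ ν I J) {f : ℝ → ℝ} (hf : Gd ν J f) : 0 ≤ DD μ ν f :=
  sub_nonneg.2 (P.order hf.cvx hf.meas hf.int).2

lemma Gd.intμ (P : Pair μ ν I J) {f : ℝ → ℝ} (hf : Gd ν J f) : Integrable f μ :=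
  (P.order hf.cvx hf.meas hf.int).1

lemma DD_congr (P : Pair μ ν I J) {f g : ℝ → ℝ} (h : ∀ x ∈ J, f x = g x) :
    DD μ ν f = DD μ ν g := by
  unfold DD
  rw [integral_congr_ae (P.aeJ.mono h), integral_congr_ae (P.aeJμ.mono h)]

lemma Gd.sub_affine (P : Pair μ ν I J) {f : ℝ → ℝ} (hf : Gd ν J f) (α β : ℝ) :
    Gd ν J (fun x => f x - (α * x + β)) ∧ DD μ ν (fun x => f x - (α * x + β)) = DD μ ν f := by
  have := P.pμ
  have := P.pν
  have h1 := integrable_affine P.iμ α β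
  have h2 := integrable_affine P.iν α β
  refine ⟨⟨convexOn_sub_affine hf.cvx _ _, by have := hf.meas; fun_prop, hf.int.sub h2⟩, ?_⟩
  unfold DD
  rw [integral_sub hf.int h2, integral_sub (hf.intμ P) h1, P.integral_affine_eq]
  ring

lemma convexOn_min {φ : ℝ → ℝ} (hφ : ConvexOn ℝ J φ) {p : ℝ}
    (hp : p ∈ J) (hmin : ∀ x ∈ J, φ p ≤ φ x) : ConvexOn ℝ J (fun x => φ (min x p)) := by
  have hmem : ∀ x ∈ J, min x p ∈ J := fun x hx => by
    rcases min_choice x p with h | h <;> rw [h] <;> assumption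
  have anti : ∀ u ∈ J, ∀ v ∈ J, u ≤ v → v ≤ p → φ v ≤ φ u := by
    intro u hu v hv huv hvp
    have := hφ.le_max_of_mem_Icc hu hp ⟨huv, hvp⟩
    rwa [max_eq_left (hmin u hu)] at this
  refine ⟨hφ.1, fun x hx y hy a b ha hb hab => ?_⟩
  have h1 := hφ.2 (hmem x hx) (hmem y hy) ha hb hab
  refine le_trans (anti _ (hφ.1 (hmem x hx) (hmem y hy) ha hb hab) _
    (hmem _ (hφ.1 hx hy ha hb hab)) ?_ (min_le_right _ _)) h1
  simp only [smul_eq_mul]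
  apply le_min
  · gcongr <;> exact min_le_left _ _
  · calc a * min x p + b * min y p ≤ a * p + b * p := by gcongr <;> exact min_le_right _ _
      _ = p := by rw [← add_mul, hab, one_mul]

lemma convexOn_max {φ : ℝ → ℝ} (hφ : ConvexOn ℝ J φ) {p : ℝ}
    (hp : p ∈ J) (hmin : ∀ x ∈ J, φ p ≤ φ x) : ConvexOn ℝ J (fun x => φ (max x p)) := by
  have hmem : ∀ x ∈ J, max x p ∈ J := fun x hx => by
    rcases max_choice x p with h | h <;> rw [h] <;> assumption
  have anti : ∀ u ∈ J, ∀ v ∈ J, v ≤ u → p ≤ v → φ v ≤ φ u := by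
    intro u hu v hv huv hvp
    have := hφ.le_max_of_mem_Icc hp hu ⟨hvp, huv⟩
    rwa [max_eq_right (hmin u hu)] at this
  refine ⟨hφ.1, fun x hx y hy a b ha hb hab => ?_⟩
  have h1 := hφ.2 (hmem x hx) (hmem y hy) ha hb hab
  refine le_trans (anti _ (hφ.1 (hmem x hx) (hmem y hy) ha hb hab) _
    (hmem _ (hφ.1 hx hy ha hb hab)) ?_ (le_max_right _ _)) h1
  simp only [smul_eq_mul]
  apply max_le
  · gcongr <;> exact le_max_left _ _
  · calc p = a * p + b * p := by rw [← add_mul, hab, one_mul]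
      _ ≤ a * max x p + b * max y p := by gcongr <;> exact le_max_right _ _

/-- tangent-reduced function -/
def tr (f : ℝ → ℝ) (p s : ℝ) : ℝ → ℝ := fun x => f x - (s * x + (f p - s * p))

lemma tr_self (f : ℝ → ℝ) (p s : ℝ) : tr f p s p = 0 := by simp [tr]

lemma tr_nonneg {f : ℝ → ℝ} {p s : ℝ} (hs : ∀ x ∈ J, f p + s * (x - p) ≤ f x) {x : ℝ}
    (hx : x ∈ J) : 0 ≤ tr f p s x := by
  have := hs x hx; simp only [tr]; linarith

lemma cut (P : Pair μ ν I J) {f : ℝ → ℝ} (hf : Gd ν J f) {p s : ℝ} (hp : p ∈ J)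
    (hs : ∀ x ∈ J, f p + s * (x - p) ≤ f x) :
    (Gd ν J (fun x => tr f p s (min x p)) ∧ Gd ν J (fun x => tr f p s (max x p))) ∧
    DD μ ν (fun x => tr f p s (min x p)) + DD μ ν (fun x => tr f p s (max x p)) = DD μ ν f := by
  obtain ⟨hg, hD⟩ := hf.sub_affine P s (f p - s * p)
  change Gd ν J (tr f p s) at hg
  change DD μ ν (tr f p s) = _ at hD
  have hmin : ∀ x ∈ J, tr f p s p ≤ tr f p s x := fun x hx => by
    rw [tr_self]; exact tr_nonneg hs hx
  have hm := hg.meas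
  have h1 : Gd ν J (fun x => tr f p s (min x p)) := by
    refine ⟨convexOn_min hg.cvx hp hmin, by fun_prop, ?_⟩
    refine hg.int.mono (Measurable.aestronglyMeasurable (by fun_prop)) (P.aeJ.mono fun x hx => ?_)
    rcases min_choice x p with h | h <;> rw [h]
    simp [tr_self]
  have h2 : Gd ν J (fun x => tr f p s (max x p)) := by
    refine ⟨convexOn_max hg.cvx hp hmin, by fun_prop, ?_⟩
    refine hg.int.mono (Measurable.aestronglyMeasurable (by fun_prop)) (P.aeJ.mono fun x hx => ?_)
    rcases max_choice x p with h | h <;> rw [h]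
    simp [tr_self]
  refine ⟨⟨h1, h2⟩, ?_⟩
  rw [← hD]
  have h3 : tr f p s = fun x => tr f p s (min x p) + tr f p s (max x p) := by
    ext x
    rcases le_total x p with h | h <;> simp [h, tr_self]
  conv_rhs => rw [h3]
  unfold DD
  rw [integral_add h1.int h2.int, integral_add (h1.intμ P) (h2.intμ P)]
  ring

lemma hinge_int {ρ : Measure ℝ} [IsProbabilityMeasure ρ] (h : Integrable id ρ) (c : ℝ) :
    Integrable (fun x => max (x - c) 0) ρ ∧
    ∫ x, max (x - c) 0 ∂ρ = (potentialFn ρ c + ((∫ x, x ∂ρ) - c)) / 2 := by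
  have he : (fun x => max (x - c) 0) = fun x => (1 / 2) * (|c - x| + (1 * x + -c)) := by
    ext x
    rcases le_total x c with h | h
    · rw [max_eq_right (by linarith), abs_of_nonneg (by linarith)]; ring
    · rw [max_eq_left (by linarith), abs_of_nonpos (by linarith)]; ring
  have h1 := integrable_abs_sub h c
  have h2 := integrable_affine h 1 (-c)
  rw [he]
  refine ⟨(h1.add h2).const_mul _, ?_⟩
  rw [integral_const_mul, integral_add h1 h2, integral_affine h]
  change 1 / 2 * (potentialFn ρ c + _) = _
  ring

lemma Pair.local_bound (P : Pair μ ν I J) {f : ℝ → ℝ} (hf : Gd ν J f) {p q s t c : ℝ}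
    (hp : p ∈ J) (hq : q ∈ J) (hpq : p ≤ q) (hst : s ≤ t)
    (hs : ∀ x ∈ J, f p + s * (x - p) ≤ f x) (ht : ∀ x ∈ J, f q + t * (x - q) ≤ f x)
    (hc : c ∈ Set.Icc p q) :
    (t - s) * ((potentialFn ν c - potentialFn μ c) / 2 - 2 * (q - p)) ≤ DD μ ν f := by
  have := P.pμ
  have := P.pν
  obtain ⟨⟨h1, h2⟩, h3⟩ := cut P hf hp hs
  set ψ : ℝ → ℝ := fun x => tr f p s (max x p) with hψ
  have hψ0 : ∀ x ∈ J, 0 ≤ ψ x := fun x hx => by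
    apply tr_nonneg hs
    rcases max_choice x p with h | h <;> rw [h] <;> assumption
  have hψt : ∀ x ∈ J, ψ q + (t - s) * (x - q) ≤ ψ x := by
    intro x hx
    simp only [hψ, max_eq_left hpq]
    rcases le_total p x with h | h
    · rw [max_eq_left h]
      have := ht x hx
      simp only [tr]; linarith
    · rw [max_eq_right h]
      have := ht p hp
      simp only [tr]
      nlinarith
  obtain ⟨⟨h4, h5⟩, h6⟩ := cut P h2 hq hψt
  have e1 := h1.nonneg P
  have e2 := h5.nonneg P
  set k0 : ℝ → ℝ := fun x => tr ψ q (t - s) (min x q) with hk0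
  obtain ⟨h7, h8⟩ := h4.sub_affine P (-(t - s)) ((t - s) * q - ψ q)
  set k : ℝ → ℝ := fun x => k0 x - (-(t - s) * x + ((t - s) * q - ψ q)) with hk
  have hψp : ψ p = 0 := by simp [hψ, tr_self]
  have hψq : ψ q ≤ (t - s) * (q - p) := by
    have := hψt p hp
    rw [hψp] at this; linarith
  have hm : 0 ≤ t - s := by linarith
  have hψq0 := hψ0 q hq
  have kle : ∀ x ∈ J, k x ≤ (t - s) * max (x - c) 0 + (t - s) * (q - p) := by
    intro x hx
    have a1 : (t - s) * 0 ≤ (t - s) * max (x - c) 0 := by gcongr; exact le_max_right _ _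
    rcases le_total x q with h | h
    · have : k x = ψ x := by simp only [hk, hk0, tr, min_eq_left h]; ring
      rw [this]
      have : ψ x ≤ ψ q := by
        rcases le_total x p with h' | h'
        · simp only [hψ, max_eq_right h', tr_self]
          exact hψq0
        · have := h2.cvx.le_max_of_mem_Icc hp hq ⟨h', h⟩
          rwa [hψp, max_eq_right hψq0] at this
      linarith
    · have a2 : k x = ψ q + (t - s) * (x - q) := by
        simp only [hk, hk0, tr, min_eq_right h]; ring
      have a3 : (t - s) * (x - q) ≤ (t - s) * max (x - c) 0 := by
        gcongr; exact (by linarith [hc.2] : x - q ≤ x - c).trans (le_max_left _ _)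
      linarith
  have lek : ∀ x ∈ J, (t - s) * max (x - c) 0 - (t - s) * (q - p) ≤ k x := by
    intro x hx
    have a1 : max (x - c) 0 ≤ max (x - q) 0 + (q - p) :=
      max_le (by linarith [hc.1, le_max_left (x - q) 0]) (by linarith [le_max_right (x - q) 0])
    have a2 := mul_le_mul_of_nonneg_left a1 hm
    rcases le_total x q with h | h
    · have : k x = ψ x := by simp only [hk, hk0, tr, min_eq_left h]; ring
      rw [this]
      rw [max_eq_right (by linarith : x - q ≤ 0)] at a2
      linarith [hψ0 x hx]
    · have a3 : k x = ψ q + (t - s) * (x - q) := by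
        simp only [hk, hk0, tr, min_eq_right h]; ring
      rw [max_eq_left (by linarith : 0 ≤ x - q)] at a2
      linarith
  obtain ⟨iμ, vμ⟩ := hinge_int P.iμ c
  obtain ⟨iν, vν⟩ := hinge_int P.iν c
  have b1 : ∫ x, ((t - s) * max (x - c) 0 - (t - s) * (q - p)) ∂ν ≤ ∫ x, k x ∂ν :=
    integral_mono_ae ((iν.const_mul _).sub (integrable_const _)) h7.int (P.aeJ.mono lek)
  have b2 : ∫ x, k x ∂μ ≤ ∫ x, ((t - s) * max (x - c) 0 + (t - s) * (q - p)) ∂μ :=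
    integral_mono_ae (h7.intμ P) ((iμ.const_mul _).add (integrable_const _)) (P.aeJμ.mono kle)
  rw [integral_sub (iν.const_mul _) (integrable_const _), integral_const_mul, vν] at b1
  rw [integral_add (iμ.const_mul _) (integrable_const _), integral_const_mul, vμ, P.mean_eq] at b2
  simp only [integral_const, probReal_univ, one_smul] at b1 b2
  have : DD μ ν k ≤ DD μ ν f := by linarith
  refine le_trans ?_ this
  unfold DD
  nlinarith

end

section

variable {μ ν : Measure ℝ} {I J : Set ℝ}

lemma Pair.slope_local (P : Pair μ ν I J) {b y : ℝ} (hb : b ∈ I) (hy : y ∈ I)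
    (hby : |y - b| < (potentialFn ν b - potentialFn μ b) / 8) {f : ℝ → ℝ} (hf : Gd ν J f)
    {s t : ℝ} (hs : ∀ x ∈ J, f b + s * (x - b) ≤ f x) (ht : ∀ x ∈ J, f y + t * (x - y) ≤ f x) :
    |s - t| ≤ 4 / (potentialFn ν b - potentialFn μ b) * DD μ ν f := by
  have hw : 0 < potentialFn ν b - potentialFn μ b := by linarith [P.lt hb]
  set w := potentialFn ν b - potentialFn μ b with hw'
  have hbJ := P.I_sub_J hb
  have hyJ := P.I_sub_J hy
  have key : |s - t| * (w / 2 - 2 * |y - b|) ≤ DD μ ν f := by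
    have h1 := hs y hyJ
    have h2 := ht b hbJ
    rcases lt_trichotomy b y with h | h | h
    · have hst : s ≤ t := by
        by_contra hc
        push Not at hc
        nlinarith
      have := P.local_bound hf hbJ hyJ h.le hst hs ht (c := b) ⟨le_rfl, h.le⟩
      rw [abs_of_nonpos (by linarith : s - t ≤ 0), abs_of_nonneg (by linarith : 0 ≤ y - b)]
      linarith
    · subst h
      rcases le_total s t with hst | hst
      · have := P.local_bound hf hbJ hyJ le_rfl hst hs ht (c := b) ⟨le_rfl, le_rfl⟩
        rw [abs_of_nonpos (by linarith : s - t ≤ 0), abs_of_nonneg (by linarith : 0 ≤ b - b)]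
        linarith
      · have := P.local_bound hf hbJ hyJ le_rfl hst ht hs (c := b) ⟨le_rfl, le_rfl⟩
        rw [abs_of_nonneg (by linarith : 0 ≤ s - t), abs_of_nonneg (by linarith : 0 ≤ b - b)]
        linarith
    · have hst : t ≤ s := by
        by_contra hc
        push Not at hc
        nlinarith
      have := P.local_bound hf hyJ hbJ h.le hst ht hs (c := b) ⟨h.le, le_rfl⟩
      rw [abs_of_nonneg (by linarith : 0 ≤ s - t), abs_of_nonpos (by linarith : y - b ≤ 0)]
      linarith
  have h3 : |s - t| * (w / 4) ≤ |s - t| * (w / 2 - 2 * |y - b|) := by gcongr; linarith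
  have h4 : |s - t| * (w / 4) ≤ DD μ ν f := h3.trans key
  calc |s - t| = 4 / w * (|s - t| * (w / 4)) := by field_simp
    _ ≤ _ := by gcongr

lemma Pair.slope (P : Pair μ ν I J) {x y : ℝ} (hx : x ∈ I) (hy : y ∈ I) :
    ∃ C : ℝ, 0 ≤ C ∧ ∀ f : ℝ → ℝ, Gd ν J f → ∀ s t : ℝ, (∀ z ∈ J, f x + s * (z - x) ≤ f z) →
      (∀ z ∈ J, f y + t * (z - y) ≤ f z) → |s - t| ≤ C * DD μ ν f := by
  refine P.preconn.induction₂ (fun x y => ∃ C : ℝ, 0 ≤ C ∧ ∀ f : ℝ → ℝ, Gd ν J f →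
    ∀ s t : ℝ, (∀ z ∈ J, f x + s * (z - x) ≤ f z) →
      (∀ z ∈ J, f y + t * (z - y) ≤ f z) → |s - t| ≤ C * DD μ ν f) ?_ ?_ ?_ hx hy
  · intro b hb
    have hw : 0 < potentialFn ν b - potentialFn μ b := by linarith [P.lt hb]
    filter_upwards [nhdsWithin_le_nhds (Metric.ball_mem_nhds b (ε := (potentialFn ν b - potentialFn μ b) / 8)
      (by linarith)), self_mem_nhdsWithin] with y h1 h2
    rw [Metric.mem_ball, Real.dist_eq] at h1
    exact ⟨4 / (potentialFn ν b - potentialFn μ b), by positivity, fun f hf s t hs ht =>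
      P.slope_local hb h2 h1 hf hs ht⟩
  · rintro x y z hx hy hz ⟨C1, h1, H1⟩ ⟨C2, h2, H2⟩
    refine ⟨C1 + C2, by linarith, fun f hf s t hs ht => ?_⟩
    obtain ⟨r, hr⟩ := P.subgr hf.cvx hy
    have a1 := H1 f hf s r hs hr
    have a2 := H2 f hf r t hr ht
    have := abs_sub_le s r t
    linarith
  · rintro x y hx hy ⟨C1, h1, H1⟩
    exact ⟨C1, h1, fun f hf s t hs ht => by rw [abs_sub_comm]; exact H1 f hf t s ht hs⟩

lemma exists_small_left [IsProbabilityMeasure μ] {y b : ℝ} (hyb : y < b)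
    (h : ∀ᵐ x ∂μ, y < x) {ε : ℝ} (hε : 0 < ε) :
    ∃ p, y < p ∧ p ≤ b ∧ μ.real (Set.Iic p) ≤ ε := by
  have h0 : ProbabilityTheory.cdf μ y = 0 := by
    rw [ProbabilityTheory.cdf_eq_real, measureReal_eq_zero_iff]
    have : Set.Iic y = {x | ¬ y < x} := by ext; simp
    rw [this]; exact h
  have h1 := (ProbabilityTheory.cdf μ).right_continuous y
  have h2 : Tendsto (ProbabilityTheory.cdf μ) (nhdsWithin y (Set.Ioi y)) (nhds 0) := by
    rw [← h0]; exact h1.mono_left (nhdsWithin_mono _ Set.Ioi_subset_Ici_self)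
  have h3 := h2.eventually (gt_mem_nhds hε)
  obtain ⟨p, hp, hp1⟩ := (h3.and (Ioc_mem_nhdsGT hyb)).exists
  exact ⟨p, hp1.1, hp1.2, by rw [← ProbabilityTheory.cdf_eq_real]; exact hp.le⟩

lemma exists_small_right [IsProbabilityMeasure μ] {y b : ℝ} (hyb : b < y)
    (h : ∀ᵐ x ∂μ, x < y) {ε : ℝ} (hε : 0 < ε) :
    ∃ p, p < y ∧ b ≤ p ∧ μ.real (Set.Ici p) ≤ ε := by
  have hm : Measurable (fun x : ℝ => -x) := measurable_neg
  have : IsProbabilityMeasure (μ.map (fun x => -x)) :=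
    Measure.isProbabilityMeasure_map hm.aemeasurable
  obtain ⟨p, h1, h2, h3⟩ := exists_small_left (μ := μ.map (fun x => -x)) (neg_lt_neg hyb)
    (by
      rw [ae_map_iff hm.aemeasurable measurableSet_Ioi]
      exact h.mono fun x hx => neg_lt_neg hx) hε
  refine ⟨-p, by linarith, by linarith, ?_⟩
  rw [map_measureReal_apply hm measurableSet_Iic] at h3
  convert h3 using 2
  ext x; simp

lemma Pair.tangent_bound (P : Pair μ ν I J) {b y : ℝ} (hb : b ∈ I) (hy : y ∈ J) :
    ∃ C : ℝ, 0 ≤ C ∧ ∀ f : ℝ → ℝ, Gd ν J f → ∀ s : ℝ, (∀ z ∈ J, f b + s * (z - b) ≤ f z) →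
      f y ≤ f b + s * (y - b) + C * DD μ ν f := by
  have := P.pμ
  have := P.pν
  have hbJ := P.I_sub_J hb
  by_cases hyI : y ∈ I
  · obtain ⟨C, hC, H⟩ := P.slope hb hyI
    refine ⟨C * |y - b|, by positivity, fun f hf s hs => ?_⟩
    obtain ⟨t, ht⟩ := P.subgr hf.cvx hyI
    have h1 := H f hf s t hs ht
    have h2 := ht b hbJ
    have h3 : (t - s) * (y - b) ≤ |s - t| * |y - b| := by
      rw [abs_sub_comm s t, ← abs_mul]; exact le_abs_self _
    have h4 : |s - t| * |y - b| ≤ C * DD μ ν f * |y - b| := by gcongr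
    nlinarith
  rcases lt_or_gt_of_ne (fun h : y = b => hyI (h ▸ hb)) with hyb | hyb
  · obtain ⟨e1, e2, -⟩ := P.left_end hb hyI hyb
    have hβ : 0 < ν.real {y} := by
      refine ENNReal.toReal_pos (pos_iff_ne_zero.1 ?_) (measure_ne_top _ _)
      have h0 : ν (Set.Iic y) ≤ ν {y} := by
        refine measure_mono_ae (e2.mono fun x hx hx' => ?_)
        exact le_antisymm hx' hx
      exact (pos_iff_ne_zero.2 (P.left_mass hy)).trans_le h0
    set β := ν.real {y} with hβ'
    obtain ⟨p, hp1, hp2, hp3⟩ := exists_small_left hyb e1 (half_pos hβ)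
    have hpI := P.mem_left hb hy hp1 hp2
    obtain ⟨C, hC, H⟩ := P.slope hb hpI
    refine ⟨2 / β + C * |y - b|, by positivity, fun f hf s hs => ?_⟩
    obtain ⟨t, ht⟩ := P.subgr hf.cvx hpI
    have h1 := H f hf s t hs ht
    have h2 := ht b hbJ
    have h3 : (t - s) * (y - b) ≤ |s - t| * |y - b| := by
      rw [abs_sub_comm s t, ← abs_mul]; exact le_abs_self _
    have h4 : |s - t| * |y - b| ≤ C * DD μ ν f * |y - b| := by gcongr
    obtain ⟨⟨g1, g2⟩, g3⟩ := cut P hf (P.I_sub_J hpI) ht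
    have g4 := g2.nonneg P
    set g : ℝ → ℝ := fun x => tr f p t (min x p) with hg
    have g0 : ∀ x ∈ J, 0 ≤ g x := fun x hx => by
      apply tr_nonneg ht
      rcases min_choice x p with h | h <;> rw [h]
      exacts [hx, P.I_sub_J hpI]
    have gp : g p = 0 := by simp [hg, tr_self]
    have hgy := g0 y hy
    have k1 : g y * β ≤ ∫ x, g x ∂ν := by
      have : ∫ x, Set.indicator {y} (fun _ => g y) x ∂ν ≤ ∫ x, g x ∂ν := by
        refine integral_mono_ae ((integrable_const _).indicator (measurableSet_singleton y)) g1.int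
          (P.aeJ.mono fun x hx => ?_)
        by_cases h : x = y
        · simp [h]
        · simp [h, g0 x hx]
      rw [integral_indicator_const _ (measurableSet_singleton y), smul_eq_mul] at this
      linarith
    have k2 : ∫ x, g x ∂μ ≤ g y * (β / 2) := by
      have : ∫ x, g x ∂μ ≤ ∫ x, Set.indicator (Set.Iic p) (fun _ => g y) x ∂μ := by
        refine integral_mono_ae (g1.intμ P) ((integrable_const _).indicator measurableSet_Iic) ?_
        filter_upwards [P.aeJμ, e1] with x hx hyx
        by_cases h : x ≤ p
        · rw [Set.indicator_of_mem (by exact h)]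
          have := g1.cvx.le_max_of_mem_Icc hy (P.I_sub_J hpI) ⟨hyx.le, h⟩
          rwa [gp, max_eq_left hgy] at this
        · rw [Set.indicator_of_notMem (by exact h)]
          simp [hg, min_eq_right (not_le.1 h).le, tr_self]
      rw [integral_indicator_const _ measurableSet_Iic, smul_eq_mul] at this
      nlinarith
    have k3 : g y * (β / 2) ≤ DD μ ν f := by
      have : DD μ ν g = ∫ x, g x ∂ν - ∫ x, g x ∂μ := rfl
      nlinarith
    have k4 : g y ≤ 2 / β * DD μ ν f := by
      calc g y = 2 / β * (g y * (β / 2)) := by field_simp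
        _ ≤ _ := by gcongr
    have k5 : g y = f y - (t * y + (f p - t * p)) := by
      simp only [hg, min_eq_left hp1.le, tr]
    nlinarith
  · obtain ⟨e1, e2, -⟩ := P.right_end hb hyI hyb
    have hβ : 0 < ν.real {y} := by
      refine ENNReal.toReal_pos (pos_iff_ne_zero.1 ?_) (measure_ne_top _ _)
      have h0 : ν (Set.Ici y) ≤ ν {y} := by
        refine measure_mono_ae (e2.mono fun x hx hx' => ?_)
        exact le_antisymm hx hx'
      exact (pos_iff_ne_zero.2 (P.right_mass hy)).trans_le h0
    set β := ν.real {y} with hβ'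
    obtain ⟨p, hp1, hp2, hp3⟩ := exists_small_right hyb e1 (half_pos hβ)
    have hpI := P.mem_right hb hy hp1 hp2
    obtain ⟨C, hC, H⟩ := P.slope hb hpI
    refine ⟨2 / β + C * |y - b|, by positivity, fun f hf s hs => ?_⟩
    obtain ⟨t, ht⟩ := P.subgr hf.cvx hpI
    have h1 := H f hf s t hs ht
    have h2 := ht b hbJ
    have h3 : (t - s) * (y - b) ≤ |s - t| * |y - b| := by
      rw [abs_sub_comm s t, ← abs_mul]; exact le_abs_self _
    have h4 : |s - t| * |y - b| ≤ C * DD μ ν f * |y - b| := by gcongr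
    obtain ⟨⟨g2, g1⟩, g3⟩ := cut P hf (P.I_sub_J hpI) ht
    have g4 := g2.nonneg P
    set g : ℝ → ℝ := fun x => tr f p t (max x p) with hg
    have g0 : ∀ x ∈ J, 0 ≤ g x := fun x hx => by
      apply tr_nonneg ht
      rcases max_choice x p with h | h <;> rw [h]
      exacts [hx, P.I_sub_J hpI]
    have gp : g p = 0 := by simp [hg, tr_self]
    have hgy := g0 y hy
    have k1 : g y * β ≤ ∫ x, g x ∂ν := by
      have : ∫ x, Set.indicator {y} (fun _ => g y) x ∂ν ≤ ∫ x, g x ∂ν := by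
        refine integral_mono_ae ((integrable_const _).indicator (measurableSet_singleton y)) g1.int
          (P.aeJ.mono fun x hx => ?_)
        by_cases h : x = y
        · simp [h]
        · simp [h, g0 x hx]
      rw [integral_indicator_const _ (measurableSet_singleton y), smul_eq_mul] at this
      linarith
    have k2 : ∫ x, g x ∂μ ≤ g y * (β / 2) := by
      have : ∫ x, g x ∂μ ≤ ∫ x, Set.indicator (Set.Ici p) (fun _ => g y) x ∂μ := by
        refine integral_mono_ae (g1.intμ P) ((integrable_const _).indicator measurableSet_Ici) ?_
        filter_upwards [P.aeJμ, e1] with x hx hyx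
        by_cases h : p ≤ x
        · rw [Set.indicator_of_mem (by exact h)]
          have := g1.cvx.le_max_of_mem_Icc (P.I_sub_J hpI) hy ⟨h, hyx.le⟩
          rwa [gp, max_eq_right hgy] at this
        · rw [Set.indicator_of_notMem (by exact h)]
          simp [hg, max_eq_right (not_le.1 h).le, tr_self]
      rw [integral_indicator_const _ measurableSet_Ici, smul_eq_mul] at this
      nlinarith
    have k3 : g y * (β / 2) ≤ DD μ ν f := by
      have : DD μ ν g = ∫ x, g x ∂ν - ∫ x, g x ∂μ := rfl
      nlinarith
    have k4 : g y ≤ 2 / β * DD μ ν f := by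
      calc g y = 2 / β * (g y * (β / 2)) := by field_simp
        _ ≤ _ := by gcongr
    have k5 : g y = f y - (t * y + (f p - t * p)) := by
      simp only [hg, max_eq_left hp1.le, tr]
    nlinarith

end

section

variable {μ ν : Measure ℝ} {I J : Set ℝ}

lemma Pair.exists_A (P : Pair μ ν I J) : ∃ p q : ℝ, p ≤ q ∧ Set.Icc p q ⊆ I ∧
    μ (Set.Icc p q) ≠ 0 := by
  by_contra! hcon
  have h0 : μ I = 0 := by
    refine measure_null_of_locally_null I fun x hx => ?_
    obtain ⟨ε, hε, hsub⟩ := Metric.nhds_basis_closedBall.mem_iff.1 (P.isOpen.mem_nhds hx)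
    refine ⟨Metric.closedBall x ε, nhdsWithin_le_nhds (Metric.closedBall_mem_nhds x hε), ?_⟩
    rw [Real.closedBall_eq_Icc] at *
    exact hcon _ _ (by linarith) hsub
  rw [P.full] at h0
  exact one_ne_zero h0

lemma Pair.exists_left (P : Pair μ ν I J) {y : ℝ} (hy : y ∈ J) :
    ∃ Y ∈ J, Y ≤ y ∧ ν (Set.Icc Y y) ≠ 0 := by
  by_contra! hcon
  have h0 : ν (J ∩ Set.Iic y) = 0 := by
    refine measure_null_of_locally_null _ fun x hx => ?_
    by_cases h : ∃ x' ∈ J, x' < x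
    · obtain ⟨x', h1, h2⟩ := h
      refine ⟨Set.Icc x' y, ?_, hcon x' h1 (h2.le.trans hx.2)⟩
      filter_upwards [self_mem_nhdsWithin, nhdsWithin_le_nhds (Ioi_mem_nhds h2)] with z hz1 hz2
      exact ⟨le_of_lt hz2, hz1.2⟩
    · push Not at h
      refine ⟨Set.Icc x y, ?_, hcon x hx.1 hx.2⟩
      filter_upwards [self_mem_nhdsWithin] with z hz1
      exact ⟨h z hz1.1, hz1.2⟩
  apply P.left_mass hy
  rw [← nonpos_iff_eq_zero, ← h0]
  exact measure_mono_ae (P.aeJ.mono fun x hx hx' => ⟨hx, hx'⟩)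

lemma Pair.exists_right (P : Pair μ ν I J) {y : ℝ} (hy : y ∈ J) :
    ∃ Y ∈ J, y ≤ Y ∧ ν (Set.Icc y Y) ≠ 0 := by
  by_contra! hcon
  have h0 : ν (J ∩ Set.Ici y) = 0 := by
    refine measure_null_of_locally_null _ fun x hx => ?_
    by_cases h : ∃ x' ∈ J, x < x'
    · obtain ⟨x', h1, h2⟩ := h
      refine ⟨Set.Icc y x', ?_, hcon x' h1 (le_trans hx.2 h2.le)⟩
      filter_upwards [self_mem_nhdsWithin, nhdsWithin_le_nhds (Iio_mem_nhds h2)] with z hz1 hz2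
      exact ⟨hz1.2, le_of_lt hz2⟩
    · push Not at h
      refine ⟨Set.Icc y x, ?_, hcon x hx.1 hx.2⟩
      filter_upwards [self_mem_nhdsWithin] with z hz1
      exact ⟨hz1.2, h z hz1.1⟩
  apply P.right_mass hy
  rw [← nonpos_iff_eq_zero, ← h0]
  exact measure_mono_ae (P.aeJ.mono fun x hx hx' => ⟨hx, hx'⟩)

lemma Pair.point_bound (P : Pair μ ν I J) {p q y : ℝ} (hpq : p ≤ q) (hA : Set.Icc p q ⊆ I)
    (hy : y ∈ J) : ∃ K : ℝ, 0 ≤ K ∧ ∀ g : ℝ → ℝ, Gd ν J g → (∀ x ∈ J, 0 ≤ g x) →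
      ∀ b ∈ Set.Icc p q, g y ≤ K * (g b + DD μ ν g) := by
  have hp : p ∈ I := hA ⟨le_rfl, hpq⟩
  have hq : q ∈ I := hA ⟨hpq, le_rfl⟩
  obtain ⟨ε, hε, hsub⟩ := Metric.nhds_basis_closedBall.mem_iff.1 (P.isOpen.mem_nhds hp)
  obtain ⟨ε', hε', hsub'⟩ := Metric.nhds_basis_closedBall.mem_iff.1 (P.isOpen.mem_nhds hq)
  rw [Real.closedBall_eq_Icc] at hsub hsub'
  have hl : p - ε ∈ J := P.I_sub_J (hsub ⟨le_rfl, by linarith⟩)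
  have hr : q + ε' ∈ J := P.I_sub_J (hsub' ⟨by linarith, le_rfl⟩)
  obtain ⟨C1, hC1, H1⟩ := P.tangent_bound hp hl
  obtain ⟨C2, hC2, H2⟩ := P.tangent_bound hp hr
  obtain ⟨C3, hC3, H3⟩ := P.tangent_bound hp hy
  set R := |y| + |p| + |q| with hR
  have hR0 : 0 ≤ R := by positivity
  set δ := min ε ε' with hδ
  have hδ0 : 0 < δ := lt_min hε hε'
  refine ⟨(1 + C1 + C2) * R / δ + 1 + C3, by positivity, fun g hg hg0 b hb => ?_⟩
  obtain ⟨s, hs⟩ := P.subgr hg.cvx hp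
  have hbJ := P.I_sub_J (hA hb)
  have a1 := H1 g hg s hs
  have a2 := H2 g hg s hs
  have a3 := H3 g hg s hs
  have a4 := hs b hbJ
  have b1 := hg0 _ hl
  have b2 := hg0 _ hr
  have b3 := hg0 _ hbJ
  have hD := hg.nonneg P
  set D := DD μ ν g
  have m1 : 0 ≤ C1 * D := by positivity
  have m2 : 0 ≤ C2 * D := by positivity
  have hd1 : δ ≤ ε := min_le_left _ _
  have hd2 : δ ≤ ε' := min_le_right _ _
  have hsd : |s| * δ ≤ g b + (C1 + C2) * D := by
    rcases le_total 0 s with h | h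
    · rw [abs_of_nonneg h]
      have : s * δ ≤ s * (b - (p - ε)) := by gcongr; linarith [hb.1]
      linarith
    · rw [abs_of_nonpos h]
      have : -s * δ ≤ -s * (q + ε' - b) := by
        apply mul_le_mul_of_nonneg_left _ (by linarith); linarith [hb.2]
      linarith
  have hyb : |y - b| ≤ R := by
    have h1 : |b| ≤ |p| + |q| := by
      rw [abs_le]; constructor
      · linarith [hb.1, neg_abs_le p, abs_nonneg q]
      · linarith [hb.2, le_abs_self q, abs_nonneg p]
    have := abs_sub y b
    linarith
  have hsy : s * (y - b) ≤ (g b + (C1 + C2) * D) * R / δ := by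
    rw [le_div_iff₀ hδ0]
    have h1 : s * (y - b) ≤ |s| * R := by
      calc s * (y - b) ≤ |s * (y - b)| := le_abs_self _
        _ = |s| * |y - b| := abs_mul _ _
        _ ≤ |s| * R := by gcongr
    calc s * (y - b) * δ ≤ |s| * R * δ := by gcongr
      _ = |s| * δ * R := by ring
      _ ≤ _ := by gcongr
  have h5 : (g b + (C1 + C2) * D) * R / δ ≤ (1 + C1 + C2) * R / δ * (g b + D) := by
    rw [div_mul_eq_mul_div]
    gcongr ?_ / δ
    have : g b + (C1 + C2) * D ≤ (1 + C1 + C2) * (g b + D) := by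
      have : 0 ≤ (C1 + C2) * g b := by positivity
      linarith
    calc (g b + (C1 + C2) * D) * R ≤ (1 + C1 + C2) * (g b + D) * R := by gcongr
      _ = _ := by ring
  have h6 : 0 ≤ C3 * g b := by positivity
  linarith

/-- one-coordinate data for the multi-dimensional induction -/
structure Coord (μ ν : Measure ℝ) (J B A T : Set ℝ) (K m : ENNReal) : Prop where
  pμ : IsProbabilityMeasure μ
  pν : IsProbabilityMeasure ν
  aeμ : ∀ᵐ x ∂μ, x ∈ J
  aeν : ∀ᵐ x ∂ν, x ∈ J
  hA : MeasurableSet A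
  AJ : A ⊆ J
  TJ : T ⊆ J
  hA0 : μ A ≠ 0
  hK : K ≠ ⊤
  hm : m ≠ 0
  order : ∀ f, Cls J f → ∫⁻ x, ENNReal.ofReal (f x) ∂μ ≤ ∫⁻ x, ENNReal.ofReal (f x) ∂ν
  key : ∀ f, Cls J f → ∫⁻ x, ENNReal.ofReal (f x) ∂ν ≠ ⊤ → ∀ (α β : ℝ) (g : ℝ → ℝ), Cls J g →
    (∀ x ∈ J, g x = f x + (α * x + β)) → ∀ b ∈ A,
    ∫⁻ x in B, ENNReal.ofReal (g x) ∂ν ≤ K * (ENNReal.ofReal (g b) +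
      (∫⁻ x, ENNReal.ofReal (f x) ∂ν - ∫⁻ x, ENNReal.ofReal (f x) ∂μ))
  markov : ∀ g, Cls J g → ∀ t ∈ T, m * ENNReal.ofReal (g t) ≤ ∫⁻ x in B, ENNReal.ofReal (g x) ∂ν

lemma Cls.gd {f : ℝ → ℝ} (hf : Cls J f) (h : ∫⁻ x, ENNReal.ofReal (f x) ∂ν ≠ ⊤) : Gd ν J f :=
  ⟨hf.cvx, hf.meas, hf.meas.aestronglyMeasurable,
    (hasFiniteIntegral_iff_ofReal (Eventually.of_forall hf.nonneg)).2 h.lt_top⟩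

lemma Pair.coord (P : Pair μ ν I J) {y z : ℝ} (hy : y ∈ J) (hz : z ∈ J) (hyz : y ≤ z) :
    ∃ B A K m, A ⊆ I ∧ Coord μ ν J B A (Set.Icc y z) K m := by
  have := P.pμ
  have := P.pν
  obtain ⟨p, q, hpq, hA, hA0⟩ := P.exists_A
  obtain ⟨Y, hY, hYy, hYm⟩ := P.exists_left hy
  obtain ⟨Z, hZ, hZz, hZm⟩ := P.exists_right hz
  obtain ⟨K1, hK1, H1⟩ := P.point_bound hpq hA hY
  obtain ⟨K2, hK2, H2⟩ := P.point_bound hpq hA hZ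
  refine ⟨Set.Icc Y Z, Set.Icc p q, ENNReal.ofReal (K1 + K2),
    min (ν (Set.Icc Y y)) (ν (Set.Icc z Z)), hA, ⟨P.pμ, P.pν, P.aeJμ, P.aeJ, measurableSet_Icc,
    hA.trans P.I_sub_J, P.hJ.out hy hz, hA0, ENNReal.ofReal_ne_top, ?_,
    fun f hf => P.order_lintegral hf.cvx (fun x _ => hf.nonneg x), ?_, ?_⟩⟩
  · rcases min_choice (ν (Set.Icc Y y)) (ν (Set.Icc z Z)) with h | h <;> rw [h] <;> assumption
  · intro f hf hfi α β g hg hgf b hb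
    have hfG := hf.gd hfi
    obtain ⟨h1, h2⟩ := hfG.sub_affine P (-α) (-β)
    have e1 : ∀ x ∈ J, f x - (-α * x + -β) = g x := fun x hx => by rw [hgf x hx]; ring
    have hgG : Gd ν J g := ⟨hg.cvx, hg.meas, h1.int.congr (P.aeJ.mono e1)⟩
    have hD : DD μ ν g = DD μ ν f := by rw [← h2]; exact (DD_congr P e1).symm
    have b1 := H1 g hgG (fun x _ => hg.nonneg x) b hb
    have b2 := H2 g hgG (fun x _ => hg.nonneg x) b hb
    have hDn := hgG.nonneg P
    have e2 : ∫⁻ x, ENNReal.ofReal (f x) ∂ν - ∫⁻ x, ENNReal.ofReal (f x) ∂μ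
        = ENNReal.ofReal (DD μ ν g) := by
      rw [hD, DD, ENNReal.ofReal_sub _ (integral_nonneg hf.nonneg),
        ofReal_integral_eq_lintegral_ofReal hfG.int (Eventually.of_forall hf.nonneg),
        ofReal_integral_eq_lintegral_ofReal (hfG.intμ P) (Eventually.of_forall hf.nonneg)]
    rw [e2, ← ENNReal.ofReal_add (hg.nonneg b) hDn, ← ENNReal.ofReal_mul (by linarith)]
    calc ∫⁻ x in Set.Icc Y Z, ENNReal.ofReal (g x) ∂ν
        ≤ ∫⁻ x in Set.Icc Y Z, ENNReal.ofReal (g Y + g Z) ∂ν := by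
          refine setLIntegral_mono measurable_const fun x hx => ENNReal.ofReal_le_ofReal ?_
          refine (hg.cvx.le_max_of_mem_Icc hY hZ hx).trans ?_
          exact max_le (by linarith [hg.nonneg Z]) (by linarith [hg.nonneg Y])
      _ ≤ ENNReal.ofReal (g Y + g Z) := by
          rw [setLIntegral_const]
          exact mul_le_of_le_one_right' prob_le_one
      _ ≤ _ := ENNReal.ofReal_le_ofReal (by linarith)
  · intro g hg t ht
    have hor : (∀ x ∈ Set.Icc Y y, g t ≤ g x) ∨ (∀ x ∈ Set.Icc z Z, g t ≤ g x) := by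
      by_contra! hcon
      obtain ⟨⟨x1, h1, h2⟩, x2, h3, h4⟩ := hcon
      have := hg.cvx.le_max_of_mem_Icc (P.hJ.out hY hy h1) (P.hJ.out hz hZ h3)
        ⟨h1.2.trans ht.1, ht.2.trans h3.1⟩
      exact absurd (this.trans_lt (max_lt h2 h4)) (lt_irrefl _)
    have main : ∀ S : Set ℝ, MeasurableSet S → S ⊆ Set.Icc Y Z → (∀ x ∈ S, g t ≤ g x) →
        ν S * ENNReal.ofReal (g t) ≤ ∫⁻ x in Set.Icc Y Z, ENNReal.ofReal (g x) ∂ν := by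
      intro S hS hsub hle
      calc ν S * ENNReal.ofReal (g t) = ∫⁻ x in S, ENNReal.ofReal (g t) ∂ν := by
            rw [setLIntegral_const, mul_comm]
        _ ≤ ∫⁻ x in S, ENNReal.ofReal (g x) ∂ν :=
            setLIntegral_mono hg.meas.ennreal_ofReal fun x hx => ENNReal.ofReal_le_ofReal (hle x hx)
        _ ≤ _ := lintegral_mono_set hsub
    rcases hor with h | h
    · exact (mul_le_mul_left (min_le_left _ _) _).trans (main _ measurableSet_Icc
        (Set.Icc_subset_Icc le_rfl (hyz.trans hZz)) h)
    · exact (mul_le_mul_left (min_le_right _ _) _).trans (main _ measurableSet_Icc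
        (Set.Icc_subset_Icc (hYy.trans hyz) le_rfl) h)

end

section

/-- the box -/
def bx {d : ℕ} (J : Fin d → Set ℝ) : Set (Fin d → ℝ) := {x | ∀ i, x i ∈ J i}

lemma measurable_finCons {n : ℕ} :
    Measurable (fun z : ℝ × (Fin n → ℝ) => (Fin.cons z.1 z.2 : Fin (n + 1) → ℝ)) := by
  rw [measurable_pi_iff]
  intro i
  refine Fin.cases ?_ (fun j => ?_) i
  · simpa using measurable_fst
  · simp only [Fin.cons_succ]; fun_prop

lemma lintegral_pi_succ {n : ℕ} (μ : Fin (n + 1) → Measure ℝ) [∀ i, SigmaFinite (μ i)]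
    {F : (Fin (n + 1) → ℝ) → ENNReal} (hF : Measurable F) :
    ∫⁻ x, F x ∂(Measure.pi μ) =
      ∫⁻ s, ∫⁻ x', F (Fin.cons s x') ∂(Measure.pi fun i => μ (Fin.succ i)) ∂(μ 0) := by
  have h := measurePreserving_piFinSuccAbove μ 0
  have hm : Measurable (fun z : ℝ × (Fin n → ℝ) => F (Fin.cons z.1 z.2)) :=
    hF.comp measurable_finCons
  have h2 := h.lintegral_comp hm
  rw [lintegral_prod _ hm.aemeasurable] at h2
  simp only [Fin.succAbove_zero] at h2
  rw [← h2]
  refine lintegral_congr fun x => ?_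
  congr 1
  exact (Fin.cons_self_tail x).symm

lemma lintegral_pi_succ_symm {n : ℕ} (μ : Fin (n + 1) → Measure ℝ) [∀ i, SigmaFinite (μ i)]
    {F : (Fin (n + 1) → ℝ) → ENNReal} (hF : Measurable F) :
    ∫⁻ x, F x ∂(Measure.pi μ) =
      ∫⁻ x', ∫⁻ s, F (Fin.cons s x') ∂(μ 0) ∂(Measure.pi fun i => μ (Fin.succ i)) := by
  rw [lintegral_pi_succ μ hF]
  exact lintegral_lintegral_swap (hF.comp measurable_finCons).aemeasurable

lemma cons_mem_bx {n : ℕ} {J : Fin (n + 1) → Set ℝ} {s : ℝ} {x : Fin n → ℝ} (hs : s ∈ J 0)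
    (hx : x ∈ bx fun i => J (Fin.succ i)) : (Fin.cons s x : Fin (n + 1) → ℝ) ∈ bx J := by
  intro i
  refine Fin.cases ?_ (fun j => ?_) i
  · simpa using hs
  · simpa using hx j

lemma cons_comb {n : ℕ} (s s' : ℝ) (x x' : Fin n → ℝ) (a b : ℝ) :
    a • (Fin.cons s x : Fin (n + 1) → ℝ) + b • (Fin.cons s' x' : Fin (n + 1) → ℝ) =
      Fin.cons (a • s + b • s') (a • x + b • x') := by
  ext i
  refine Fin.cases ?_ (fun j => ?_) i <;> simp

lemma Cls.slice_fst {n : ℕ} {J : Fin (n + 1) → Set ℝ} {χ : (Fin (n + 1) → ℝ) → ℝ}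
    (h : Cls (bx J) χ) (hJ : ∀ i, Convex ℝ (J i)) {x : Fin n → ℝ}
    (hx : x ∈ bx fun i => J (Fin.succ i)) :
    Cls (J 0) (fun s => χ (Fin.cons s x)) := by
  refine ⟨⟨hJ 0, fun s hs s' hs' a b ha hb hab => ?_⟩, fun s => h.nonneg _,
    h.meas.comp (measurable_finCons.comp (measurable_id.prodMk measurable_const))⟩
  have := h.cvx.2 (cons_mem_bx hs hx) (cons_mem_bx hs' hx) ha hb hab
  rw [cons_comb, ← add_smul, hab, one_smul] at this
  exact this

lemma convex_bx {n : ℕ} {J : Fin n → Set ℝ} (hJ : ∀ i, Convex ℝ (J i)) : Convex ℝ (bx J) :=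
  fun _ hx _ hy _ _ ha hb hab i => hJ i (hx i) (hy i) ha hb hab

lemma Cls.slice_snd {n : ℕ} {J : Fin (n + 1) → Set ℝ} {χ : (Fin (n + 1) → ℝ) → ℝ}
    (h : Cls (bx J) χ) (hJ : ∀ i, Convex ℝ (J i)) {s : ℝ} (hs : s ∈ J 0) :
    Cls (bx fun i => J (Fin.succ i)) (fun x => χ (Fin.cons s x)) := by
  refine ⟨⟨convex_bx fun i => hJ _, fun x hx x' hx' a b ha hb hab => ?_⟩, fun s => h.nonneg _,
    h.meas.comp (measurable_finCons.comp (measurable_const.prodMk measurable_id))⟩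
  have := h.cvx.2 (cons_mem_bx hs hx) (cons_mem_bx hs hx') ha hb hab
  rw [cons_comb, ← add_smul, hab, one_smul] at this
  exact this

lemma ae_bx {n : ℕ} {ν : Fin n → Measure ℝ} {J : Fin n → Set ℝ} [∀ i, SigmaFinite (ν i)]
    (h : ∀ i, ∀ᵐ x ∂(ν i), x ∈ J i) : ∀ᵐ x ∂(Measure.pi ν), x ∈ bx J := by
  have : ∀ᵐ x ∂(Measure.pi ν), ∀ i, x i ∈ J i :=
    ae_all_iff.2 fun i => (Measure.tendsto_eval_ae_ae (μ := ν) (i := i)).eventually (h i)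
  exact this

lemma order_pi : ∀ (n : ℕ) (μ ν : Fin n → Measure ℝ) (J B A T : Fin n → Set ℝ)
    (K m : Fin n → ENNReal) (_ : ∀ i, Coord (μ i) (ν i) (J i) (B i) (A i) (T i) (K i) (m i))
    (_ : ∀ i, Convex ℝ (J i)) (χ : (Fin n → ℝ) → ℝ), Cls (bx J) χ →
    ∫⁻ x, ENNReal.ofReal (χ x) ∂(Measure.pi μ) ≤ ∫⁻ x, ENNReal.ofReal (χ x) ∂(Measure.pi ν) := by
  intro n
  induction n with
  | zero =>
    intro μ ν J B A T K m hC hJ χ hχ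
    rw [Measure.pi_of_empty, Measure.pi_of_empty]
  | succ n ih =>
    intro μ ν J B A T K m hC hJ χ hχ
    have := fun i => (hC i).pμ
    have := fun i => (hC i).pν
    have hm := hχ.meas.ennreal_ofReal
    rw [lintegral_pi_succ μ hm, lintegral_pi_succ_symm ν hm]
    calc _ ≤ ∫⁻ s, ∫⁻ x', ENNReal.ofReal (χ (Fin.cons s x'))
            ∂(Measure.pi fun i => ν (Fin.succ i)) ∂(μ 0) := by
          refine lintegral_mono_ae ((hC 0).aeμ.mono fun s hs => ?_)
          exact ih _ _ _ _ _ _ _ _ (fun i => hC (Fin.succ i)) (fun i => hJ _) _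
            (hχ.slice_snd hJ hs)
      _ = ∫⁻ x', ∫⁻ s, ENNReal.ofReal (χ (Fin.cons s x')) ∂(μ 0)
            ∂(Measure.pi fun i => ν (Fin.succ i)) :=
          lintegral_lintegral_swap (hm.comp measurable_finCons).aemeasurable
      _ ≤ _ := by
          refine lintegral_mono_ae ((ae_bx fun i => (hC (Fin.succ i)).aeν).mono fun x hx => ?_)
          exact (hC 0).order _ (hχ.slice_fst hJ hx)

lemma markov_pi : ∀ (n : ℕ) (μ ν : Fin n → Measure ℝ) (J B A T : Fin n → Set ℝ)
    (K m : Fin n → ENNReal) (_ : ∀ i, Coord (μ i) (ν i) (J i) (B i) (A i) (T i) (K i) (m i))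
    (_ : ∀ i, Convex ℝ (J i)) (χ : (Fin n → ℝ) → ℝ), Cls (bx J) χ → ∀ t ∈ bx T,
    (∏ i, m i) * ENNReal.ofReal (χ t) ≤
      ∫⁻ x, ENNReal.ofReal (χ x) ∂(Measure.pi fun i => (ν i).restrict (B i)) := by
  intro n
  induction n with
  | zero =>
    intro μ ν J B A T K m hC hJ χ hχ t ht
    rw [Measure.pi_of_empty, lintegral_dirac]
    simp [Subsingleton.elim t isEmptyElim]
  | succ n ih =>
    intro μ ν J B A T K m hC hJ χ hχ t ht
    have := fun i => (hC i).pν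
    have hm := hχ.meas.ennreal_ofReal
    rw [lintegral_pi_succ_symm _ hm]
    have htt : (Fin.cons (t 0) (fun i => t (Fin.succ i)) : Fin (n + 1) → ℝ) = t :=
      Fin.cons_self_tail t
    have hae : ∀ᵐ x ∂(Measure.pi fun i : Fin n => (ν (Fin.succ i)).restrict (B (Fin.succ i))),
        x ∈ bx fun i => J (Fin.succ i) :=
      ae_bx fun i => ae_restrict_of_ae (hC (Fin.succ i)).aeν
    calc (∏ i, m i) * ENNReal.ofReal (χ t)
        = m 0 * ((∏ i : Fin n, m (Fin.succ i)) *
          ENNReal.ofReal (χ (Fin.cons (t 0) (fun i => t (Fin.succ i))))) := by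
          rw [Fin.prod_univ_succ, htt, mul_assoc]
      _ ≤ m 0 * ∫⁻ x, ENNReal.ofReal (χ (Fin.cons (t 0) x))
            ∂(Measure.pi fun i : Fin n => (ν (Fin.succ i)).restrict (B (Fin.succ i))) := by
          gcongr
          exact ih _ _ _ _ _ _ _ _ (fun i => hC (Fin.succ i)) (fun i => hJ _) _
            (hχ.slice_snd hJ ((hC 0).TJ (ht 0))) _ (fun i => ht _)
      _ = ∫⁻ x, m 0 * ENNReal.ofReal (χ (Fin.cons (t 0) x))
            ∂(Measure.pi fun i : Fin n => (ν (Fin.succ i)).restrict (B (Fin.succ i))) := by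
          rw [lintegral_const_mul]
          exact (hχ.slice_snd hJ ((hC 0).TJ (ht 0))).meas.ennreal_ofReal
      _ ≤ _ := lintegral_mono_ae (hae.mono fun x hx =>
          (hC 0).markov _ (hχ.slice_fst hJ hx) _ (ht 0))

lemma core_pi : ∀ (n : ℕ) (μ ν : Fin n → Measure ℝ) (J B A T : Fin n → Set ℝ)
    (K m : Fin n → ENNReal) (_ : ∀ i, Coord (μ i) (ν i) (J i) (B i) (A i) (T i) (K i) (m i))
    (_ : ∀ i, Convex ℝ (J i)), ∃ L : ENNReal, L ≠ ⊤ ∧ ∀ (C : ENNReal) (χ : (Fin n → ℝ) → ℝ),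
    Cls (bx J) χ → ∫⁻ x, ENNReal.ofReal (χ x) ∂(Measure.pi ν) ≠ ⊤ →
    ∫⁻ x, ENNReal.ofReal (χ x) ∂(Measure.pi ν) ≤ C + ∫⁻ x, ENNReal.ofReal (χ x) ∂(Measure.pi μ) →
    ∃ c ∈ bx A, ∀ (w : Fin n → ℝ) (β : ℝ) (g : (Fin n → ℝ) → ℝ), Cls (bx J) g →
      (∀ x ∈ bx J, g x = χ x + (∑ i, w i * x i + β)) →
      ∫⁻ x, ENNReal.ofReal (g x) ∂(Measure.pi fun i => (ν i).restrict (B i)) ≤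
        L * (ENNReal.ofReal (g c) + C) := by
  intro n
  induction n with
  | zero =>
    intro μ ν J B A T K m hC hJ
    refine ⟨1, ENNReal.one_ne_top, fun C χ hχ _ _ => ⟨isEmptyElim, fun i => i.elim0,
      fun w β g hg _ => ?_⟩⟩
    rw [Measure.pi_of_empty, lintegral_dirac, one_mul]
    exact le_self_add
  | succ n ih =>
    intro μ ν J B A T K m hC hJ
    have := fun i => (hC i).pμ
    have := fun i => (hC i).pν
    obtain ⟨L, hL, H⟩ := ih _ _ _ _ _ _ _ _ (fun i => hC (Fin.succ i)) (fun i => hJ (Fin.succ i))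
    have hord := order_pi n _ _ _ _ _ _ _ _ (fun i => hC (Fin.succ i)) (fun i => hJ (Fin.succ i))
    set μ' := Measure.pi fun i : Fin n => μ (Fin.succ i) with hμ'
    set ν' := Measure.pi fun i : Fin n => ν (Fin.succ i) with hν'
    set J' : Fin n → Set ℝ := fun i => J (Fin.succ i) with hJ'
    set a := (μ 0 (A 0)) with ha
    refine ⟨K 0 * (L * (1 + a⁻¹) + 1), ?_, fun C χ hχ hfin hle => ?_⟩
    · have h1 : a⁻¹ ≠ ⊤ := ENNReal.inv_ne_top.2 (hC 0).hA0
      exact ENNReal.mul_ne_top (hC 0).hK (by finiteness)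
    have hm := hχ.meas.ennreal_ofReal
    have hmc : Measurable (fun z : ℝ × (Fin n → ℝ) => ENNReal.ofReal (χ (Fin.cons z.1 z.2))) :=
      hm.comp measurable_finCons
    set p : (Fin n → ℝ) → ENNReal := fun x => ∫⁻ s, ENNReal.ofReal (χ (Fin.cons s x)) ∂(ν 0) with hp
    set q : (Fin n → ℝ) → ENNReal := fun x => ∫⁻ s, ENNReal.ofReal (χ (Fin.cons s x)) ∂(μ 0) with hq
    set t : ℝ → ENNReal := fun s => ∫⁻ x, ENNReal.ofReal (χ (Fin.cons s x)) ∂ν' with ht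
    set r : ℝ → ENNReal := fun s => ∫⁻ x, ENNReal.ofReal (χ (Fin.cons s x)) ∂μ' with hr
    have hpm : Measurable p := hmc.lintegral_prod_left'
    have hqm : Measurable q := hmc.lintegral_prod_left'
    have htm : Measurable t := hmc.lintegral_prod_right'
    have hrm : Measurable r := hmc.lintegral_prod_right'
    rw [lintegral_pi_succ μ hm, lintegral_pi_succ_symm ν hm] at hle
    rw [lintegral_pi_succ_symm ν hm] at hfin
    change ∫⁻ x, p x ∂ν' ≤ C + ∫⁻ s, r s ∂(μ 0) at hle
    change ∫⁻ x, p x ∂ν' ≠ ⊤ at hfin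
    have hswap : ∫⁻ s, t s ∂(μ 0) = ∫⁻ x, q x ∂ν' := lintegral_lintegral_swap hmc.aemeasurable
    have haeν : ∀ᵐ x ∂ν', x ∈ bx J' := ae_bx fun i => (hC (Fin.succ i)).aeν
    have hqp : ∀ᵐ x ∂ν', q x ≤ p x := haeν.mono fun x hx => (hC 0).order _ (hχ.slice_fst hJ hx)
    have hrt : ∀ᵐ s ∂(μ 0), r s ≤ t s := (hC 0).aeμ.mono fun s hs => hord _ (hχ.slice_snd hJ hs)
    have hqpi : ∫⁻ x, q x ∂ν' ≤ ∫⁻ x, p x ∂ν' := lintegral_mono_ae hqp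
    have hrti : ∫⁻ s, r s ∂(μ 0) ≤ ∫⁻ s, t s ∂(μ 0) := lintegral_mono_ae hrt
    have hqfin : ∫⁻ x, q x ∂ν' ≠ ⊤ := ne_top_of_le_ne_top hfin hqpi
    have htfin : ∫⁻ s, t s ∂(μ 0) ≠ ⊤ := hswap ▸ hqfin
    have hrfin : ∫⁻ s, r s ∂(μ 0) ≠ ⊤ := ne_top_of_le_ne_top htfin hrti
    have hpq : ∫⁻ x, (p x - q x) ∂ν' ≤ C := by
      rw [lintegral_sub hqm hqfin hqp]
      refine tsub_le_iff_right.2 (hle.trans ?_)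
      gcongr
      exact hrti.trans hswap.le
    have htr : ∫⁻ s, (t s - r s) ∂(μ 0) ≤ C := by
      rw [lintegral_sub hrm hrfin hrt]
      refine tsub_le_iff_right.2 (le_trans ?_ hle)
      exact hswap.le.trans hqpi
    -- choice of the first coordinate
    have hpos := measure_le_setLAverage_pos (μ := μ 0) (s := A 0) (f := fun s => t s - r s)
      (hC 0).hA0 (measure_ne_top _ _) (htm.sub hrm).aemeasurable
    have hset : ∃ c0 ∈ A 0, t c0 ≠ ⊤ ∧ t c0 - r c0 ≤ C * a⁻¹ := by
      have htae : ∀ᵐ s ∂(μ 0), t s < ⊤ := ae_lt_top htm htfin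
      have hne : μ 0 ({x | x ∈ A 0 ∧ t x - r x ≤ ⨍⁻ s in A 0, (t s - r s) ∂(μ 0)} ∩ {s | t s < ⊤})
          ≠ 0 := by
        rw [measure_inter_conull]
        · exact hpos.ne'
        · exact htae
      obtain ⟨c0, ⟨h1, h2⟩, h3⟩ := nonempty_of_measure_ne_zero hne
      refine ⟨c0, h1, (show t c0 < ⊤ from h3).ne, h2.trans ?_⟩
      rw [setLAverage_eq, ENNReal.div_eq_inv_mul, mul_comm]
      gcongr
      exact (setLIntegral_le_lintegral _ _).trans htr
    obtain ⟨c0, hc0, htc, htrc⟩ := hset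
    have hc0J := (hC 0).AJ hc0
    obtain ⟨c', hc', Hc⟩ := H (C * a⁻¹) (fun x => χ (Fin.cons c0 x)) (hχ.slice_snd hJ hc0J) htc
      (tsub_le_iff_right.1 htrc)
    refine ⟨Fin.cons c0 c', cons_mem_bx hc0 hc', fun w β g hg hgχ => ?_⟩
    have hgm := hg.meas.ennreal_ofReal
    have hg2 := Hc (fun i => w (Fin.succ i)) (w 0 * c0 + β) (fun x => g (Fin.cons c0 x))
      (hg.slice_snd hJ hc0J) (fun x hx => by
        rw [hgχ _ (cons_mem_bx hc0J hx), Fin.sum_univ_succ]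
        simp only [Fin.cons_zero, Fin.cons_succ]
        ring)
    set σ' := Measure.pi fun i : Fin n => (ν (Fin.succ i)).restrict (B (Fin.succ i)) with hσ'
    have hσr : σ' = ν'.restrict (Set.univ.pi fun i => B (Fin.succ i)) :=
      (Measure.restrict_pi_pi _ _).symm
    have hkey : ∀ᵐ x ∂σ', ∫⁻ s in B 0, ENNReal.ofReal (g (Fin.cons s x)) ∂(ν 0) ≤
        K 0 * (ENNReal.ofReal (g (Fin.cons c0 x)) + (p x - q x)) := by
      rw [hσr]
      apply ae_restrict_of_ae
      filter_upwards [haeν, ae_lt_top hpm hfin] with x hx hpx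
      refine (hC 0).key _ (hχ.slice_fst hJ hx) hpx.ne (w 0)
        (∑ i : Fin n, w (Fin.succ i) * x i + β) _ (hg.slice_fst hJ hx) (fun s hs => ?_) c0 hc0
      rw [hgχ _ (cons_mem_bx hs hx), Fin.sum_univ_succ]
      simp only [Fin.cons_zero, Fin.cons_succ]
      ring
    rw [lintegral_pi_succ_symm _ hgm]
    have hgs := (hg.slice_snd hJ hc0J).meas.ennreal_ofReal
    calc ∫⁻ x, ∫⁻ s in B 0, ENNReal.ofReal (g (Fin.cons s x)) ∂(ν 0) ∂σ'
        ≤ ∫⁻ x, K 0 * (ENNReal.ofReal (g (Fin.cons c0 x)) + (p x - q x)) ∂σ' :=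
          lintegral_mono_ae hkey
      _ = K 0 * (∫⁻ x, ENNReal.ofReal (g (Fin.cons c0 x)) ∂σ' + ∫⁻ x, (p x - q x) ∂σ') := by
          rw [lintegral_const_mul, lintegral_add_left hgs]
          exact hgs.add (hpm.sub hqm)
      _ ≤ K 0 * (L * (ENNReal.ofReal (g (Fin.cons c0 c')) + C * a⁻¹) + C) := by
          gcongr
          · rw [hσr]
            exact (setLIntegral_le_lintegral _ _).trans hpq
      _ ≤ _ := by
          rw [mul_assoc]
          gcongr
          set G := ENNReal.ofReal (g (Fin.cons c0 c'))
          have : G + C * a⁻¹ ≤ (1 + a⁻¹) * (G + C) := by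
            calc G + C * a⁻¹ ≤ (G + C * a⁻¹) + (C + a⁻¹ * G) := le_self_add
              _ = _ := by ring
          calc L * (G + C * a⁻¹) + C ≤ L * ((1 + a⁻¹) * (G + C)) + (G + C) := by
                gcongr
                exact le_add_self
            _ = _ := by ring

end

section

lemma countable_ends {J : Set ℝ} (hJ : Set.OrdConnected J) : (J \ interior J).Countable := by
  have hsub : J \ interior J ⊆ {x | IsLeast J x} ∪ {x | IsGreatest J x} := by
    intro x hx
    by_contra hcon
    simp only [Set.mem_union, Set.mem_ofPred_eq, not_or, IsLeast, IsGreatest, hx.1, true_and,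
      lowerBounds, upperBounds, not_forall, not_le] at hcon
    obtain ⟨⟨y, hy, hyx⟩, z, hz, hxz⟩ := hcon
    apply hx.2
    exact interior_maximal (Set.Ioo_subset_Icc_self.trans (hJ.out hy hz)) isOpen_Ioo ⟨hyx, hxz⟩
  refine Set.Countable.mono hsub (Set.Countable.union ?_ ?_)
  · exact Set.Subsingleton.countable fun x hx y hy => hx.unique hy
  · exact Set.Subsingleton.countable fun x hx y hy => hx.unique hy

/-- face patterns -/
abbrev Pat {d : ℕ} (J : Fin d → Set ℝ) := ∀ i, Option ↥(J i \ interior (J i))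

lemma countable_pat {d : ℕ} {J : Fin d → Set ℝ} (hJ : ∀ i, Set.OrdConnected (J i)) :
    Countable (Pat J) := by
  have : ∀ i, Countable ↥(J i \ interior (J i)) := fun i => (countable_ends (hJ i)).to_subtype
  infer_instance

variable {d : ℕ} {J : Fin d → Set ℝ}

def fU (e : Pat J) : Set (Fin d → ℝ) := {x | ∀ i, e i = none → x i ∈ interior (J i)}

def fP (e : Pat J) (x : Fin d → ℝ) : Fin d → ℝ := fun i => ((e i).map Subtype.val).getD (x i)

lemma fP_mem {e : Pat J} {x : Fin d → ℝ} (hx : x ∈ fU e) : fP e x ∈ bx J := by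
  intro i
  unfold fP
  cases h : e i with
  | none => simpa using interior_subset (hx i h)
  | some v => simpa using v.2.1

lemma fP_comb (e : Pat J) (x y : Fin d → ℝ) {a b : ℝ} (hab : a + b = 1) :
    fP e (a • x + b • y) = a • fP e x + b • fP e y := by
  ext i
  simp only [fP, Pi.add_apply, Pi.smul_apply, smul_eq_mul]
  cases h : e i with
  | none => simp
  | some v => simp [← add_mul, hab]

lemma continuous_fP (e : Pat J) : Continuous (fP e) := by
  refine continuous_pi fun i => ?_
  unfold fP
  cases h : e i with
  | none => simpa using continuous_apply i
  | some v => simpa using continuous_const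

lemma isOpen_fU (e : Pat J) : IsOpen (fU e) := by
  have : fU e = ⋂ i, {x | e i = none → x i ∈ interior (J i)} := by ext; simp [fU]
  rw [this]
  refine isOpen_iInter_of_finite fun i => ?_
  by_cases h : e i = none
  · simp only [h, forall_const]
    exact isOpen_interior.preimage (continuous_apply i)
  · simp [h]

lemma convex_fU (hJ : ∀ i, Convex ℝ (J i)) (e : Pat J) : Convex ℝ (fU e) :=
  fun _ hx _ hy _ _ ha hb hab i hi => (hJ i).interior (hx i hi) (hy i hi) ha hb hab

lemma convexOn_face (hJ : ∀ i, Convex ℝ (J i)) {χ : (Fin d → ℝ) → ℝ} (hχ : ConvexOn ℝ (bx J) χ)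
    (e : Pat J) : ConvexOn ℝ (fU e) (fun x => χ (fP e x)) := by
  refine ⟨convex_fU hJ e, fun x hx y hy a b ha hb hab => ?_⟩
  simp only [fP_comb e x y hab]
  exact hχ.2 (fP_mem hx) (fP_mem hy) ha hb hab

open Classical in
def patOf {x : Fin d → ℝ} (hx : x ∈ bx J) : Pat J :=
  fun i => if h : x i ∈ interior (J i) then none else some ⟨x i, hx i, h⟩

lemma patOf_mem {x : Fin d → ℝ} (hx : x ∈ bx J) : x ∈ fU (patOf hx) := by
  intro i hi
  by_contra h
  simp [patOf, h] at hi

lemma patOf_fix {x : Fin d → ℝ} (hx : x ∈ bx J) : fP (patOf hx) x = x := by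
  ext i
  unfold fP
  by_cases h : x i ∈ interior (J i) <;> simp [patOf, h]

lemma measurableSet_bx (hJ : ∀ i, Set.OrdConnected (J i)) : MeasurableSet (bx J) := by
  have : bx J = Set.univ.pi J := by ext; simp [bx]
  rw [this]
  exact MeasurableSet.univ_pi fun i => (hJ i).measurableSet

lemma measurable_indicator_convex (hJ : ∀ i, Set.OrdConnected (J i)) {χ : (Fin d → ℝ) → ℝ}
    (hχ : ConvexOn ℝ (bx J) χ) : Measurable ((bx J).indicator χ) := by
  classical
  have hJc : ∀ i, Convex ℝ (J i) := fun i => (hJ i).convex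
  have := countable_pat hJ
  set F : Pat J → Set (Fin d → ℝ) := fun e => fU e ∩ {x | fP e x = x} with hF
  have hFm : ∀ e, MeasurableSet (F e) := fun e => (isOpen_fU e).measurableSet.inter
    (isClosed_eq (continuous_fP e) continuous_id).measurableSet
  have hFJ : ∀ e, F e ⊆ bx J := fun e x hx => by
    have := fP_mem hx.1
    rwa [hx.2] at this
  set h : Pat J → (Fin d → ℝ) → ℝ := fun e => (fU e).piecewise (fun x => χ (fP e x)) 0 with hh
  have hhm : ∀ e, Measurable (h e) := fun e =>
    ((convexOn_face hJc hχ e).continuousOn (isOpen_fU e)).measurable_piecewise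
      continuous_zero.continuousOn (isOpen_fU e).measurableSet
  intro V hV
  have heq : (bx J).indicator χ ⁻¹' V =
      (⋃ e, F e ∩ h e ⁻¹' V) ∪ ((bx J)ᶜ ∩ {_x | (0 : ℝ) ∈ V}) := by
    ext x
    simp only [Set.mem_preimage, Set.mem_union, Set.mem_iUnion, Set.mem_inter_iff, Set.mem_compl_iff,
      Set.mem_ofPred_eq]
    have hFe : ∀ e, x ∈ F e → h e x = χ x := fun e hx => by
      simp only [hh]
      rw [Set.piecewise_eq_of_mem _ _ _ hx.1, hx.2]
    by_cases hx : x ∈ bx J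
    · rw [Set.indicator_of_mem hx]
      constructor
      · intro hV
        have hmem : x ∈ F (patOf hx) := ⟨patOf_mem hx, patOf_fix hx⟩
        exact Or.inl ⟨patOf hx, hmem, by rwa [hFe _ hmem]⟩
      · rintro (⟨e, he, hV⟩ | ⟨h1, _⟩)
        · rwa [hFe e he] at hV
        · exact absurd hx h1
    · rw [Set.indicator_of_notMem hx]
      constructor
      · exact fun h0 => Or.inr ⟨hx, h0⟩
      · rintro (⟨e, he, hV⟩ | ⟨_, h0⟩)
        · exact absurd (hFJ e he) hx
        · exact h0
  rw [heq]
  exact (MeasurableSet.iUnion fun e => (hFm e).inter (hhm e hV)).union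
    ((measurableSet_bx hJ).compl.inter (MeasurableSet.const _))

lemma cls_indicator (hJ : ∀ i, Set.OrdConnected (J i)) {χ : (Fin d → ℝ) → ℝ}
    (hχ : ConvexOn ℝ (bx J) χ) (h0 : ∀ x ∈ bx J, 0 ≤ χ x) : Cls (bx J) ((bx J).indicator χ) := by
  refine ⟨hχ.congr fun x hx => (Set.indicator_of_mem hx χ).symm, fun x => ?_,
    measurable_indicator_convex hJ hχ⟩
  exact Set.indicator_nonneg h0 x

lemma lintegral_indicator_bx (hJ : ∀ i, Set.OrdConnected (J i)) (χ : (Fin d → ℝ) → ℝ)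
    (ρ : Measure (Fin d → ℝ)) : ∫⁻ x in bx J, ENNReal.ofReal (χ x) ∂ρ =
      ∫⁻ x, ENNReal.ofReal ((bx J).indicator χ x) ∂ρ := by
  rw [← lintegral_indicator (measurableSet_bx hJ)]
  refine lintegral_congr fun x => ?_
  by_cases hx : x ∈ bx J <;> simp [hx]

lemma part_a {μ ν : Fin d → Measure ℝ} {I : Fin d → Set ℝ} (P : ∀ i, Pair (μ i) (ν i) (I i) (J i))
    {a : Fin d → ℝ} (ha : ∀ i, a i ∈ I i) (C : ℝ) {S : Set (Fin d → ℝ)} (hS : S ⊆ bx J)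
    (hSc : IsCompact S) : ∃ M : ℝ, ∀ χ : (Fin d → ℝ) → ℝ, memLambda d (bx J) a C μ ν χ →
      ∀ x ∈ S, χ x ≤ M := by
  have hJ : ∀ i, Set.OrdConnected (J i) := fun i => (P i).hJ
  have hJc : ∀ i, Convex ℝ (J i) := fun i => (P i).cvxJ
  have hIo : IsOpen (bx I) := by
    have : bx I = Set.univ.pi I := by ext; simp [bx]
    rw [this]
    exact isOpen_set_pi Set.finite_univ fun i _ => (P i).isOpen
  have hIJ : bx I ⊆ bx J := fun x hx i => (P i).I_sub_J (hx i)
  obtain ⟨η, hη, hball⟩ := Metric.nhds_basis_closedBall.mem_iff.1 (hIo.mem_nhds (show a ∈ bx I from ha))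
  have hηJ : ∀ i, Set.Icc (a i - η) (a i + η) ⊆ J i := by
    intro i t ht
    have h1 : a + (fun _ => t - a i) ∈ Metric.closedBall a η := by
      rw [mem_closedBall_iff_norm, add_sub_cancel_left]
      refine (pi_norm_le_iff_of_nonneg hη.le).2 fun j => ?_
      rw [Real.norm_eq_abs, abs_le]
      constructor <;> linarith [ht.1, ht.2]
    have := hIJ (hball h1) i
    simpa using this
  -- the box
  have hbox : ∀ i, ∃ y z, y ∈ J i ∧ z ∈ J i ∧ y ≤ a i - η ∧ a i + η ≤ z ∧
      ∀ x ∈ S, x i ∈ Set.Icc y z := by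
    intro i
    set Q := (fun x : Fin d → ℝ => x i) '' S ∪ Set.Icc (a i - η) (a i + η) with hQ
    have hQc : IsCompact Q := (hSc.image (continuous_apply i)).union isCompact_Icc
    have hl : a i - η ∈ Q := Or.inr ⟨le_rfl, by linarith⟩
    have hr : a i + η ∈ Q := Or.inr ⟨by linarith, le_rfl⟩
    have hQJ : Q ⊆ J i := by
      rintro t (⟨x, hx, rfl⟩ | ht)
      · exact hS hx i
      · exact hηJ i ht
    refine ⟨sInf Q, sSup Q, hQJ (hQc.sInf_mem ⟨_, hl⟩), hQJ (hQc.sSup_mem ⟨_, hl⟩),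
      csInf_le hQc.bddBelow hl, le_csSup hQc.bddAbove hr, fun x hx => ?_⟩
    have : x i ∈ Q := Or.inl ⟨x, hx, rfl⟩
    exact ⟨csInf_le hQc.bddBelow this, le_csSup hQc.bddAbove this⟩
  choose y z hy hz hya haz hSyz using hbox
  have hco : ∀ i, ∃ B A K m, A ⊆ I i ∧ Coord (μ i) (ν i) (J i) B A (Set.Icc (y i) (z i)) K m :=
    fun i => (P i).coord (hy i) (hz i) (by linarith [hya i, haz i])
  choose B A K m hAI hC using hco
  obtain ⟨L, hL, H⟩ := core_pi d μ ν J B A _ K m hC hJc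
  have hmk := markov_pi d μ ν J B A _ K m hC hJc
  set m0 := ∏ i, m i with hm0
  have hm0' : m0 ≠ 0 := Finset.prod_ne_zero_iff.2 fun i _ => (hC i).hm
  set M0 : ℝ := (L * ENNReal.ofReal C / m0).toReal with hM0
  have hM0n : 0 ≤ M0 := ENNReal.toReal_nonneg
  set R : ℝ := ∑ i, (z i - y i) + 1 with hR
  have hyz : ∀ i, 0 ≤ z i - y i := fun i => by linarith [hya i, haz i]
  have hRpos : 0 < R := by
    have : 0 ≤ ∑ i, (z i - y i) := Finset.sum_nonneg fun i _ => hyz i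
    linarith
  have hRi : ∀ i, z i - y i ≤ R := fun i => by
    have := Finset.single_le_sum (f := fun i => z i - y i) (fun i _ => hyz i) (Finset.mem_univ i)
    linarith
  set τ := η / R with hτ
  have hτ0 : 0 < τ := by positivity
  refine ⟨M0 + M0 / τ, fun χ hχ x hxS => ?_⟩
  obtain ⟨hcv, hn, hχa, hfμ, hle⟩ := hχ
  have hfν : ∫⁻ x in bx J, ENNReal.ofReal (χ x) ∂(Measure.pi ν) ≠ ⊤ :=
    ne_top_of_le_ne_top (ENNReal.add_ne_top.2 ⟨ENNReal.ofReal_ne_top, hfμ⟩) hle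
  rw [lintegral_indicator_bx hJ, lintegral_indicator_bx hJ] at hle
  rw [lintegral_indicator_bx hJ] at hfν
  obtain ⟨c, hc, Hc⟩ := H (ENNReal.ofReal C) _ (cls_indicator hJ hcv hn) hfν hle
  have hcI : c ∈ bx I := fun i => hAI i (hc i)
  have hcJ := hIJ hcI
  obtain ⟨l, hl⟩ := exists_subgradient hcv (interior_maximal hIJ hIo hcI)
  set g0 : (Fin d → ℝ) → ℝ := fun x => χ x - (χ c + l (x - c)) with hg0
  have hg0n : ∀ x ∈ bx J, 0 ≤ g0 x := fun x hx => by have := hl x hx; simp only [hg0]; linarith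
  have hg0c : ConvexOn ℝ (bx J) g0 := by
    refine ⟨hcv.1, fun u hu v hv s t hs ht hst => ?_⟩
    have h1 := hcv.2 hu hv hs ht hst
    simp only [hg0, map_sub, map_add, map_smul, smul_eq_mul] at h1 ⊢
    have h2 : χ c - l c = s * (χ c - l c) + t * (χ c - l c) := by rw [← add_mul, hst, one_mul]
    linarith
  have hgC := cls_indicator hJ hg0c hg0n
  have hlsum : ∀ v : Fin d → ℝ, l v = ∑ i, l (Pi.single i 1) * v i := by
    intro v
    conv_lhs => rw [← Finset.univ_sum_single v]
    rw [map_sum]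
    refine Finset.sum_congr rfl fun i _ => ?_
    have : (Pi.single i (v i) : Fin d → ℝ) = v i • Pi.single i (1 : ℝ) := by
      rw [← Pi.single_smul, smul_eq_mul, mul_one]
    rw [this, map_smul, smul_eq_mul, mul_comm]
  have hHg := Hc (fun i => -l (Pi.single i 1)) (l c - χ c) _ hgC (fun v hv => by
    rw [Set.indicator_of_mem hv, Set.indicator_of_mem hv]
    simp only [hg0, map_sub, neg_mul, Finset.sum_neg_distrib]
    rw [← hlsum v]; ring)
  have hgc : (bx J).indicator g0 c = 0 := by
    rw [Set.indicator_of_mem hcJ]; simp [hg0]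
  rw [hgc, ENNReal.ofReal_zero, zero_add] at hHg
  have hbxJ : ∀ t, (∀ i, t i ∈ Set.Icc (y i) (z i)) → t ∈ bx J := fun t ht i => (hC i).TJ (ht i)
  have hgM : ∀ t, (∀ i, t i ∈ Set.Icc (y i) (z i)) → g0 t ≤ M0 := by
    intro t ht
    have h1 := (hmk _ hgC t ht).trans hHg
    rw [Set.indicator_of_mem (hbxJ t ht)] at h1
    have h2 : ENNReal.ofReal (g0 t) ≤ L * ENNReal.ofReal C / m0 := by
      rw [ENNReal.le_div_iff_mul_le (Or.inl hm0') (Or.inr (by finiteness)), mul_comm]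
      exact h1
    have h3 : L * ENNReal.ofReal C / m0 ≠ ⊤ := ENNReal.div_ne_top (by finiteness) hm0'
    exact (ENNReal.ofReal_le_iff_le_toReal h3).1 h2
  have hxT : ∀ i, x i ∈ Set.Icc (y i) (z i) := fun i => hSyz i x hxS
  set x' : Fin d → ℝ := a - τ • (x - a) with hx'
  have hx'T : ∀ i, x' i ∈ Set.Icc (y i) (z i) := by
    intro i
    have h1 : |x i - a i| ≤ R := by
      rw [abs_le]
      constructor <;> linarith [(hxT i).1, (hxT i).2, hRi i, hya i, haz i]
    have h2 : |τ * (x i - a i)| ≤ η := by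
      rw [abs_mul, abs_of_pos hτ0]
      calc τ * |x i - a i| ≤ τ * R := by gcongr
        _ = η := by rw [hτ]; field_simp
    rw [abs_le] at h2
    simp only [hx', Pi.sub_apply, Pi.smul_apply, smul_eq_mul]
    constructor <;> linarith [hya i, haz i]
  have k1 := hgM x hxT
  have k2 := hgM x' hx'T
  have k3 := hn x' (hbxJ x' hx'T)
  have k4 := hl a (hIJ ha)
  rw [hχa] at k4
  simp only [hg0, hx', map_sub, map_smul, smul_eq_mul] at k1 k2 k3 k4
  have k5 : τ * (χ c + (l x - l c)) ≤ M0 := by nlinarith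
  have k6 : χ c + (l x - l c) ≤ M0 / τ := by
    rw [le_div_iff₀ hτ0]; linarith
  linarith

end

section

lemma part_b {d : ℕ} {J : Fin d → Set ℝ} {μ ν : Fin d → Measure ℝ} {I : Fin d → Set ℝ}
    (P : ∀ i, Pair (μ i) (ν i) (I i) (J i))
    {a : Fin d → ℝ} (ha : ∀ i, a i ∈ I i) (C : ℝ) (χ : ℕ → (Fin d → ℝ) → ℝ)
    (hχ : ∀ n, memLambda d (bx J) a C μ ν (χ n)) :
    ∃ ψ : ℕ → ℕ, StrictMono ψ ∧ ∃ χlim : (Fin d → ℝ) → ℝ, ConvexOn ℝ (bx J) χlim ∧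
      ∀ x ∈ bx J, Tendsto (fun j => χ (ψ j) x) atTop (nhds (χlim x)) := by
  classical
  have hJ : ∀ i, Set.OrdConnected (J i) := fun i => (P i).hJ
  have hJc : ∀ i, Convex ℝ (J i) := fun i => (P i).cvxJ
  have := countable_pat hJ
  set D := TopologicalSpace.denseSeq (Fin d → ℝ) with hD
  set v : ℕ → (Pat J × ℕ → ℝ) := fun n p =>
    if D p.2 ∈ fU p.1 then χ n (fP p.1 (D p.2)) else 0 with hv
  have hbd : ∀ p : Pat J × ℕ, ∃ M : ℝ, ∀ n, v n p ∈ Set.Icc 0 M := by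
    intro p
    by_cases h : D p.2 ∈ fU p.1
    · obtain ⟨M, hM⟩ := part_a P ha C (S := {fP p.1 (D p.2)})
        (Set.singleton_subset_iff.2 (fP_mem h)) isCompact_singleton
      refine ⟨M, fun n => ?_⟩
      simp only [hv, if_pos h]
      exact ⟨(hχ n).2.1 _ (fP_mem h), hM _ (hχ n) _ rfl⟩
    · exact ⟨0, fun n => by simp [hv, h]⟩
  choose M hM using hbd
  have hcomp : IsCompact (Set.univ.pi fun p => Set.Icc 0 (M p)) :=
    isCompact_univ_pi fun p => isCompact_Icc
  obtain ⟨w, -, ψ, hψ, hlim⟩ := hcomp.tendsto_subseq (x := v) (fun n p _ => hM p n)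
  have hlim' : ∀ p, Tendsto (fun j => v (ψ j) p) atTop (nhds (w p)) := fun p =>
    (tendsto_pi_nhds.1 hlim) p
  have key : ∀ x ∈ bx J, ∃ l, Tendsto (fun j => χ (ψ j) x) atTop (nhds l) := by
    intro x hx
    set e := patOf hx with he
    obtain ⟨r, hr, hball⟩ := Metric.nhds_basis_closedBall.mem_iff.1
      ((isOpen_fU e).mem_nhds (patOf_mem hx))
    obtain ⟨B, hB⟩ := part_a P ha C (S := fP e '' Metric.closedBall x r)
      (by rintro _ ⟨y, hy, rfl⟩; exact fP_mem (hball hy))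
      ((isCompact_closedBall x r).image (continuous_fP e))
    have hLip : ∀ n, LipschitzOnWith (2 * B / (r / 2)).toNNReal (fun y => χ n (fP e y))
        (Metric.ball x (r - r / 2)) := by
      intro n
      refine ConvexOn.lipschitzOnWith_of_abs_le
        ((convexOn_face hJc (hχ n).1 e).subset (Metric.ball_subset_closedBall.trans hball)
          (convex_ball x r)) (by positivity) fun y hy => ?_
      have hy' : y ∈ Metric.closedBall x r := Metric.mem_closedBall.2 hy.le
      rw [abs_of_nonneg ((hχ n).2.1 _ (fP_mem (hball hy')))]
      exact hB _ (hχ n) _ ⟨y, hy', rfl⟩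
    set L := (2 * B / (r / 2)).toNNReal
    refine cauchySeq_tendsto_of_complete (Metric.cauchySeq_iff.2 fun ε hε => ?_)
    set δ := min (r / 2) (ε / (3 * (L + 1))) with hδ
    have hL0 : (0 : ℝ) ≤ L := L.2
    have hδ0 : 0 < δ := by positivity
    obtain ⟨k, hk⟩ := (TopologicalSpace.denseRange_denseSeq (Fin d → ℝ)).exists_dist_lt x hδ0
    change dist x (D k) < δ at hk
    have hkr : dist x (D k) < r / 2 := hk.trans_le (min_le_left _ _)
    have hkε : L * dist x (D k) ≤ ε / 3 := by
      have h1 : dist x (D k) ≤ ε / (3 * (L + 1)) := hk.le.trans (min_le_right _ _)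
      rw [le_div_iff₀ (by positivity)] at h1
      nlinarith [dist_nonneg (x := x) (y := D k)]
    have hkU : D k ∈ fU e := hball (by
      rw [Metric.mem_closedBall, dist_comm]; linarith)
    have hest : ∀ n, |χ n x - v n (e, k)| ≤ ε / 3 := by
      intro n
      have h1 := (hLip n).dist_le_mul x (Metric.mem_ball_self (by linarith)) (D k)
        (by rw [Metric.mem_ball, dist_comm]; linarith)
      simp only [patOf_fix hx, he, Real.dist_eq] at h1
      simp only [hv, if_pos hkU]
      exact h1.trans hkε
    obtain ⟨N, hN⟩ := Metric.cauchySeq_iff.1 (hlim' (e, k)).cauchySeq (ε / 3) (by positivity)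
    refine ⟨N, fun m hm n hn => ?_⟩
    have h1 := hN m hm n hn
    have h2 := hest (ψ m)
    have h3 := hest (ψ n)
    rw [Real.dist_eq, abs_lt] at h1 ⊢
    rw [abs_le] at h2 h3
    constructor <;> linarith [h1.1, h1.2, h2.1, h2.2, h3.1, h3.2]
  choose! l hl using key
  refine ⟨ψ, hψ, l, ⟨(hχ 0).1.1, fun x hx y hy s t hs ht hst => ?_⟩, hl⟩
  exact le_of_tendsto_of_tendsto' (hl _ ((hχ 0).1.1 hx hy hs ht hst))
    (((hl x hx).const_smul s).add ((hl y hy).const_smul t))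
    fun j => (hχ (ψ j)).1.2 hx hy hs ht hst

end

/-- Stability of convex cores: local boundedness and pointwise-convergent subsequences
for the class Λ associated to irreducible pairs. -/
theorem convex_core_stability (d : ℕ) (hd : 1 ≤ d)
    (μ ν : Fin d → Measure ℝ)
    (hμ : ∀ i, IsProbabilityMeasure (μ i)) (hν : ∀ i, IsProbabilityMeasure (ν i))
    (hμm : ∀ i, Integrable id (μ i)) (hνm : ∀ i, Integrable id (ν i))
    (hord : ∀ i, ConvexOrder1 (μ i) (ν i))
    (hirr : ∀ i, IrreduciblePair (μ i) (ν i))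
    (I J : Fin d → Set ℝ)
    (hI : ∀ i, I i = {x | potentialFn (μ i) x < potentialFn (ν i) x})
    (hJint : ∀ i, Set.OrdConnected (J i))
    (hJfull : ∀ i, ν i (J i) = 1)
    (hJmin : ∀ i, ∀ J' : Set ℝ, Set.OrdConnected J' → ν i J' = 1 → J i ⊆ J')
    (a : Fin d → ℝ) (ha : ∀ i, a i ∈ I i) (C : ℝ) :
    (∀ K : Set (Fin d → ℝ), K ⊆ {x | ∀ i, x i ∈ J i} → IsCompact K →
      ∃ M : ℝ, ∀ χ : (Fin d → ℝ) → ℝ,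
        memLambda d {x | ∀ i, x i ∈ J i} a C μ ν χ → ∀ x ∈ K, χ x ≤ M) ∧
    (∀ χseq : ℕ → (Fin d → ℝ) → ℝ,
      (∀ n, memLambda d {x | ∀ i, x i ∈ J i} a C μ ν (χseq n)) →
      ∃ ψ : ℕ → ℕ, StrictMono ψ ∧
        ∃ χlim : (Fin d → ℝ) → ℝ,
          ConvexOn ℝ {x | ∀ i, x i ∈ J i} χlim ∧
          ∀ x ∈ {x : Fin d → ℝ | ∀ i, x i ∈ J i},
            Tendsto (fun j => χseq (ψ j) x) atTop (nhds (χlim x))) := by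
  have P : ∀ i, Pair (μ i) (ν i) (I i) (J i) := fun i =>
    ⟨hμ i, hν i, hμm i, hνm i, hord i, hirr i, hI i, hJint i, hJfull i, hJmin i⟩
  exact ⟨fun K hK hKc => part_a P ha C hK hKc, fun χ hχ => part_b P ha C χ hχ⟩
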